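/- arXiv:1605.04184 — 9 statements merged into one kernel-verified Lean document; each statement's English description precedes it below -/
import Mathlib

section
/- Let P and Q be mutually absolutely continuous probability measures on a measurable space and let f be a bounded measurable real-valued function. Then |E_Q(f) − E_P(f)| ≤ ‖f‖_∞ · √(2 · R(Q‖P)), where ‖f‖_∞ is the essential supremum of |f| and R(Q‖P) is the relative entropy of Q with respect to P. (Csiszár–Kullback–Pinsker inequality for quantities of interest.) -/
open MeasureTheory

/-- Relative entropy (Kullback–Leibler divergence) `R(Q‖P) = ∫ log(dQ/dP) dQ`. -/
noncomputable def relEnt {Ω : Type*} [MeasurableSpace Ω] (Q P : Measure Ω) : ℝ :=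
  ∫ x, Real.log ((Q.rnDeriv P x).toReal) ∂Q

open InformationTheory in
/-- The Fenchel–Young inequality for `klFun` and its conjugate `y ↦ exp y - 1`. -/
lemma mul_le_klFun_add_exp_sub_one {x : ℝ} (hx : 0 ≤ x) (y : ℝ) :
    x * y ≤ klFun x + (Real.exp y - 1) := by
  rcases hx.eq_or_lt with rfl | hx
  · simpa [klFun_apply] using (Real.exp_pos y).le
  · have h := mul_le_mul_of_nonneg_left (Real.add_one_le_exp (y - Real.log x)) hx.le
    rw [Real.exp_sub, Real.exp_log hx, mul_div_cancel₀ _ hx.ne'] at h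
    rw [klFun_apply]
    linarith

open InformationTheory ProbabilityTheory in
/-- Hoeffding's lemma combined with the variational bound for the relative entropy. -/
lemma mul_integral_sub_integral_le_relEnt_add {Ω : Type*} [MeasurableSpace Ω] {P Q : Measure Ω}
    [IsProbabilityMeasure P] [IsProbabilityMeasure Q] (hQP : Q ≪ P)
    {f : Ω → ℝ} (hf : Measurable f) {M : ℝ} (hM : ∀ᵐ x ∂P, |f x| ≤ M)
    (hR : Integrable (fun x => Real.log ((Q.rnDeriv P x).toReal)) Q) (t : ℝ) :
    t * ((∫ x, f x ∂Q) - ∫ x, f x ∂P) ≤ relEnt Q P + M ^ 2 * t ^ 2 / 2 := by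
  have hfP : Integrable f P := .of_bound hf.aestronglyMeasurable M hM
  have hfQ : Integrable f Q := .of_bound hf.aestronglyMeasurable M (hQP hM)
  have hsub := hasSubgaussianMGF_of_mem_Icc hf.aemeasurable
    (hM.mono fun x hx => (⟨(abs_le.1 hx).1, (abs_le.1 hx).2⟩ : f x ∈ Set.Icc (-M) M))
  have hmgf := hsub.mgf_le t
  set g : Ω → ℝ := fun x => t * (f x - ∫ y, f y ∂P) - M ^ 2 * t ^ 2 / 2
  have hcQ : Integrable (fun x => t * (f x - ∫ y, f y ∂P)) Q :=
    (hfQ.sub (integrable_const _)).const_mul t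
  have hgQ : Integrable g Q := hcQ.sub (integrable_const _)
  have hexp (x : Ω) : Real.exp (g x) =
      Real.exp (t * (f x - ∫ y, f y ∂P)) * Real.exp (-(M ^ 2 * t ^ 2 / 2)) := by
    rw [← Real.exp_add, ← sub_eq_add_neg]
  have hexp_int : Integrable (fun x => Real.exp (g x)) P := by
    simp_rw [hexp]
    exact (hsub.integrable_exp_mul t).mul_const _
  have hexp_le : ∫ x, Real.exp (g x) ∂P ≤ 1 := by
    simp_rw [hexp]
    rw [integral_mul_const, Real.exp_neg, ← div_eq_mul_inv, div_le_one (Real.exp_pos _)]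
    refine hmgf.trans (Real.exp_le_exp.2 (le_of_eq ?_))
    have : ((‖M - -M‖₊ / 2) ^ 2 : NNReal) = (M ^ 2 : ℝ) := by
      push_cast
      rw [Real.norm_eq_abs, div_pow, sq_abs]
      ring
    rw [this]
  have hkl : Integrable (fun x => klFun (Q.rnDeriv P x).toReal) P :=
    (integrable_klFun_rnDeriv_iff hQP).2 hR
  have hklR : ∫ x, klFun (Q.rnDeriv P x).toReal ∂P = relEnt Q P := by
    rw [integral_klFun_rnDeriv hQP hR]
    simp [relEnt, llr]
  have hexp_sub : Integrable (fun x => Real.exp (g x) - 1) P := hexp_int.sub (integrable_const _)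
  have key : ∫ x, (Q.rnDeriv P x).toReal • g x ∂P ≤
      ∫ x, (klFun (Q.rnDeriv P x).toReal + (Real.exp (g x) - 1)) ∂P :=
    integral_mono ((integrable_rnDeriv_smul_iff hQP).2 hgQ)
      (hkl.add hexp_sub)
      fun x => mul_le_klFun_add_exp_sub_one ENNReal.toReal_nonneg _
  rw [integral_rnDeriv_smul hQP, integral_add hkl hexp_sub,
    integral_sub hexp_int (integrable_const _), hklR] at key
  have hgQ_eq : ∫ x, g x ∂Q =
      t * ((∫ x, f x ∂Q) - ∫ x, f x ∂P) - M ^ 2 * t ^ 2 / 2 := by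
    rw [integral_sub hcQ (integrable_const _),
      integral_const_mul, integral_sub hfQ (integrable_const _)]
    simp
  simp only [integral_const, probReal_univ, one_smul] at key
  linarith

/-- Csiszár–Kullback–Pinsker inequality for quantities of interest. -/
theorem stmt_0 {Ω : Type*} [MeasurableSpace Ω] (P Q : Measure Ω)
    [IsProbabilityMeasure P] [IsProbabilityMeasure Q]
    (hQP : Q ≪ P) (hPQ : P ≪ Q)
    (f : Ω → ℝ) (hf : Measurable f) (C : ℝ) (hbdd : ∀ x, |f x| ≤ C)
    (hR : Integrable (fun x => Real.log ((Q.rnDeriv P x).toReal)) Q) :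
    |(∫ x, f x ∂Q) - ∫ x, f x ∂P| ≤
      essSup (fun x => |f x|) P * Real.sqrt (2 * relEnt Q P) := by
  have hM : ∀ᵐ x ∂P, |f x| ≤ essSup (fun x => |f x|) P :=
    ae_le_essSup (Filter.isBoundedUnder_of ⟨C, hbdd⟩)
  set M := essSup (fun x => |f x|) P
  obtain ⟨x, hx⟩ := hM.exists
  have hM0 : 0 ≤ M := (abs_nonneg _).trans hx
  have hdisc := discrim_le_zero (a := M ^ 2 / 2) (b := -((∫ x, f x ∂Q) - ∫ x, f x ∂P))
    (c := relEnt Q P) fun t => by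
      linarith [mul_integral_sub_integral_le_relEnt_add hQP hf hM hR t]
  rw [discrim] at hdisc
  rw [← Real.sqrt_sq hM0, ← Real.sqrt_mul (sq_nonneg M)]
  exact Real.abs_le_sqrt (by linarith)
end

section
/- Let P and Q be mutually absolutely continuous probability measures on a measurable space, let f be a bounded measurable real-valued function, and let 0 < α ≤ 1. Then |E_Q(f) − E_P(f)| ≤ ‖f‖_∞ · √((2/α) · D_α(Q‖P)), where D_α is the Rényi divergence of order α (with D_1 taken to be the relative entropy). (Generalized Pinsker inequality for quantities of interest.) -/
open MeasureTheory

/-- Rényi divergence of order `α` of `Q` with respect to `P`, with the convention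
`D₁(Q‖P) = R(Q‖P)` (the relative entropy). -/
noncomputable def renyiDiv {Ω : Type*} [MeasurableSpace Ω] (α : ℝ) (Q P : Measure Ω) : ℝ :=
  if α = 1 then ∫ x, Real.log ((Q.rnDeriv P x).toReal) ∂Q
  else (α - 1)⁻¹ * Real.log (∫ x, ((Q.rnDeriv P x).toReal) ^ α ∂P)

open ProbabilityTheory

/-- Exponential form of Hoeffding's lemma for a random variable bounded by `c` in absolute value. -/
theorem integral_exp_mul_le_of_abs_le {Ω : Type*} [MeasurableSpace Ω] {μ : Measure Ω}
    [IsProbabilityMeasure μ] {f : Ω → ℝ} (hf : AEMeasurable f μ) {c : ℝ}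
    (hc : ∀ᵐ x ∂μ, |f x| ≤ c) (t : ℝ) :
    Integrable (fun x => Real.exp (t * f x)) μ ∧
      ∫ x, Real.exp (t * f x) ∂μ ≤ Real.exp (t * ∫ x, f x ∂μ + c ^ 2 * t ^ 2 / 2) := by
  have hmem : ∀ᵐ x ∂μ, f x ∈ Set.Icc (-c) c := by
    filter_upwards [hc] with x hx using abs_le.mp hx
  have hsub := hasSubgaussianMGF_of_mem_Icc hf hmem
  have hsplit : (fun x => Real.exp (t * f x)) =
      fun x => Real.exp (t * ∫ x, f x ∂μ) * Real.exp (t * (f x - ∫ x, f x ∂μ)) := by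
    funext x
    rw [← Real.exp_add]
    ring_nf
  have hle := hsub.mgf_le t
  have hcoe : (((‖c - -c‖₊ / 2) ^ 2 : NNReal) : ℝ) = c ^ 2 := by
    push_cast
    rw [Real.norm_eq_abs, div_pow, sq_abs]
    ring
  rw [hcoe, mgf] at hle
  rw [hsplit]
  refine ⟨(hsub.integrable_exp_mul t).const_mul _, ?_⟩
  rw [integral_const_mul, Real.exp_add]
  gcongr

/-- Young's inequality in exponentially tilted form. -/
theorem rpow_le_tilted_arith_mean {α x : ℝ} (hα0 : 0 ≤ α) (hα1 : α ≤ 1) (hx : 0 ≤ x) (w : ℝ) :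
    x ^ α ≤ α * (x * Real.exp (-(1 - α) * w)) + (1 - α) * Real.exp (α * w) := by
  have h := Real.geom_mean_le_arith_mean2_weighted hα0 (sub_nonneg.mpr hα1)
    (mul_nonneg hx (Real.exp_nonneg (-(1 - α) * w))) (Real.exp_nonneg (α * w)) (by ring)
  refine le_of_eq_of_le ?_ h
  rw [Real.mul_rpow hx (Real.exp_nonneg _), ← Real.exp_mul, ← Real.exp_mul, mul_assoc,
    ← Real.exp_add]
  ring_nf
  simp

section

variable {Ω : Type*} [MeasurableSpace Ω] {P Q : Measure Ω}
  [IsProbabilityMeasure P] [IsProbabilityMeasure Q]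

theorem integrable_rnDeriv_rpow {α : ℝ} (hα0 : 0 ≤ α) (hα1 : α ≤ 1) :
    Integrable (fun x => ((Q.rnDeriv P x).toReal) ^ α) P := by
  refine Integrable.mono'
    ((Measure.integrable_toReal_rnDeriv (μ := Q) (ν := P)).const_mul α |>.add
      (integrable_const (1 - α)))
    ((Measure.measurable_rnDeriv Q P).ennreal_toReal.pow_const α).aestronglyMeasurable ?_
  refine Filter.Eventually.of_forall fun x => ?_
  rw [Real.norm_of_nonneg (Real.rpow_nonneg ENNReal.toReal_nonneg α)]
  simpa using rpow_le_tilted_arith_mean hα0 hα1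
    (ENNReal.toReal_nonneg (a := Q.rnDeriv P x)) 0

theorem integral_rnDeriv_rpow_pos (hPQ : P ≪ Q) {α : ℝ} (hα0 : 0 ≤ α) (hα1 : α ≤ 1) :
    0 < ∫ x, ((Q.rnDeriv P x).toReal) ^ α ∂P := by
  have hnonneg (x : Ω) : 0 ≤ ((Q.rnDeriv P x).toReal) ^ α :=
    Real.rpow_nonneg ENNReal.toReal_nonneg α
  rw [integral_pos_iff_support_of_nonneg hnonneg (integrable_rnDeriv_rpow hα0 hα1)]
  have hsupp : Function.support (fun x => ((Q.rnDeriv P x).toReal) ^ α) =ᵐ[P] Set.univ := by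
    rw [Filter.eventuallyEq_univ]
    filter_upwards [Measure.rnDeriv_pos' hPQ, Measure.rnDeriv_lt_top Q P] with x h0 h1
    exact (Real.rpow_pos_of_pos (ENNReal.toReal_pos h0.ne' h1.ne) α).ne'
  rw [measure_congr hsupp, measure_univ]
  exact one_pos

/-- Bound on the Hellinger integral of order `α` through the means of a bounded function. -/
theorem integral_rnDeriv_rpow_le (hQP : Q ≪ P) {α : ℝ} (hα0 : 0 ≤ α) (hα1 : α ≤ 1)
    {f : Ω → ℝ} (hf : Measurable f) {c : ℝ} (hc : ∀ᵐ x ∂P, |f x| ≤ c) (t : ℝ) :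
    ∫ x, ((Q.rnDeriv P x).toReal) ^ α ∂P ≤
      Real.exp (α * (1 - α) * (c ^ 2 * t ^ 2 / 2 - t * ((∫ x, f x ∂Q) - ∫ x, f x ∂P))) := by
  set a := ∫ x, f x ∂Q
  set b := ∫ x, f x ∂P
  obtain ⟨hintQ, hleQ⟩ :=
    integral_exp_mul_le_of_abs_le hf.aemeasurable (hQP.ae_le hc) (-(1 - α) * t)
  obtain ⟨hintP, hleP⟩ := integral_exp_mul_le_of_abs_le hf.aemeasurable hc (α * t)
  -- this shift makes the two exponential bounds coincide
  let k := -(1 - α) * t * a + c ^ 2 * (-(1 - α) * t) ^ 2 / 2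
    - (α * t * b + c ^ 2 * (α * t) ^ 2 / 2)
  set E := Real.exp (α * (1 - α) * (c ^ 2 * t ^ 2 / 2 - t * (a - b))) with hE
  have hpt (x : Ω) : ((Q.rnDeriv P x).toReal) ^ α ≤
      α * Real.exp (-(1 - α) * k) *
        ((Q.rnDeriv P x).toReal • Real.exp (-(1 - α) * t * f x)) +
      (1 - α) * Real.exp (α * k) * Real.exp (α * t * f x) := by
    refine (rpow_le_tilted_arith_mean hα0 hα1 ENNReal.toReal_nonneg (t * f x + k)).trans_eq ?_
    rw [mul_add, mul_add, Real.exp_add, Real.exp_add, smul_eq_mul]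
    ring_nf
  have hintQ' := ((integrable_rnDeriv_smul_iff hQP).mpr hintQ).const_mul
    (α * Real.exp (-(1 - α) * k))
  have hintP' := hintP.const_mul ((1 - α) * Real.exp (α * k))
  have hEQ : Real.exp (-(1 - α) * k) *
      Real.exp (-(1 - α) * t * a + c ^ 2 * (-(1 - α) * t) ^ 2 / 2) = E := by
    rw [← Real.exp_add, hE]
    congr 1
    simp only [k]
    ring
  have hEP : Real.exp (α * k) * Real.exp (α * t * b + c ^ 2 * (α * t) ^ 2 / 2) = E := by
    rw [← Real.exp_add, hE]
    congr 1
    simp only [k]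
    ring
  have h1α : 0 ≤ 1 - α := sub_nonneg.mpr hα1
  calc ∫ x, ((Q.rnDeriv P x).toReal) ^ α ∂P
      ≤ α * Real.exp (-(1 - α) * k) * ∫ x, Real.exp (-(1 - α) * t * f x) ∂Q +
        (1 - α) * Real.exp (α * k) * ∫ x, Real.exp (α * t * f x) ∂P := by
        refine (integral_mono (integrable_rnDeriv_rpow hα0 hα1) (hintQ'.add hintP') hpt).trans_eq ?_
        simp only [Pi.add_apply]
        rw [integral_add hintQ' hintP', integral_const_mul, integral_const_mul,
          integral_rnDeriv_smul hQP]
    _ ≤ α * Real.exp (-(1 - α) * k) *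
          Real.exp (-(1 - α) * t * a + c ^ 2 * (-(1 - α) * t) ^ 2 / 2) +
        (1 - α) * Real.exp (α * k) * Real.exp (α * t * b + c ^ 2 * (α * t) ^ 2 / 2) := by
        gcongr
    _ = E := by
        rw [mul_assoc, hEQ, mul_assoc, hEP]
        ring

/-- Relative entropy bound obtained from the Gibbs variational principle and Hoeffding's lemma. -/
theorem le_integral_llr_of_abs_le (hQP : Q ≪ P) (hR : Integrable (llr Q P) Q)
    {f : Ω → ℝ} (hf : Measurable f) {c : ℝ} (hc : ∀ᵐ x ∂P, |f x| ≤ c) (t : ℝ) :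
    t * ((∫ x, f x ∂Q) - ∫ x, f x ∂P) - c ^ 2 * t ^ 2 / 2 ≤ ∫ x, llr Q P x ∂Q := by
  obtain ⟨hint, hle⟩ := integral_exp_mul_le_of_abs_le hf.aemeasurable hc t
  have hfQ : Integrable (fun x => t * f x) Q :=
    (Integrable.of_bound hf.aestronglyMeasurable c (hQP.ae_le hc)).const_mul t
  have : IsProbabilityMeasure (P.tilted fun x => t * f x) := isProbabilityMeasure_tilted hint
  have hgibbs := InformationTheory.integral_llr_add_sub_measure_univ_nonneg
    (hQP.trans (absolutelyContinuous_tilted hint)) (integrable_llr_tilted_right hQP hfQ hR hint)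
  rw [integral_llr_tilted_right hQP hfQ hint hR, integral_const_mul] at hgibbs
  simp only [probReal_univ] at hgibbs
  have hlog := (Real.log_le_iff_le_exp (integral_exp_pos hint)).mpr hle
  linarith

end

theorem le_renyiDiv_of_abs_le {Ω : Type*} [MeasurableSpace Ω] {P Q : Measure Ω}
    [IsProbabilityMeasure P] [IsProbabilityMeasure Q] (hQP : Q ≪ P) (hPQ : P ≪ Q)
    {α : ℝ} (hα0 : 0 ≤ α) (hα1 : α ≤ 1) {f : Ω → ℝ} (hf : Measurable f)
    {c : ℝ} (hc : ∀ᵐ x ∂P, |f x| ≤ c)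
    (hR : α = 1 → Integrable (fun x => Real.log ((Q.rnDeriv P x).toReal)) Q) (t : ℝ) :
    α * (t * ((∫ x, f x ∂Q) - ∫ x, f x ∂P) - c ^ 2 * t ^ 2 / 2) ≤ renyiDiv α Q P := by
  unfold renyiDiv
  split_ifs with h
  · rw [h, one_mul]
    exact le_integral_llr_of_abs_le hQP (hR h) hf hc t
  · have hlt : 0 < 1 - α := sub_pos.mpr (lt_of_le_of_ne hα1 h)
    have hlog := (Real.log_le_iff_le_exp (integral_rnDeriv_rpow_pos hPQ hα0 hα1)).mpr
      (integral_rnDeriv_rpow_le hQP hα0 hα1 hf hc t)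
    rw [← neg_sub 1 α, inv_neg, neg_mul, ← mul_neg, ← div_eq_inv_mul, le_div_iff₀ hlt]
    linarith

/-- Generalized Pinsker inequality for quantities of interest. -/
theorem stmt_1 {Ω : Type*} [MeasurableSpace Ω] (P Q : Measure Ω)
    [IsProbabilityMeasure P] [IsProbabilityMeasure Q]
    (hQP : Q ≪ P) (hPQ : P ≪ Q)
    (α : ℝ) (hα0 : 0 < α) (hα1 : α ≤ 1)
    (f : Ω → ℝ) (hf : Measurable f) (C : ℝ) (hbdd : ∀ x, |f x| ≤ C)
    (hR : α = 1 → Integrable (fun x => Real.log ((Q.rnDeriv P x).toReal)) Q) :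
    |(∫ x, f x ∂Q) - ∫ x, f x ∂P| ≤
      essSup (fun x => |f x|) P * Real.sqrt ((2 / α) * renyiDiv α Q P) := by
  have hc : ∀ᵐ x ∂P, |f x| ≤ essSup (fun x => |f x|) P :=
    ae_le_essSup (Filter.isBoundedUnder_of ⟨C, hbdd⟩)
  set c := essSup (fun x => |f x|) P
  set Δ := (∫ x, f x ∂Q) - ∫ x, f x ∂P
  have hc0 : 0 ≤ c := by
    obtain ⟨x, hx⟩ := hc.exists
    exact (abs_nonneg _).trans hx
  have hdiscrim := discrim_le_zero (a := α * c ^ 2 / 2) (b := -(α * Δ)) (c := renyiDiv α Q P)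
    fun t => by linarith [le_renyiDiv_of_abs_le hQP hPQ hα0.le hα1 hf hc hR t]
  have hsq : Δ ^ 2 ≤ c ^ 2 * (2 / α * renyiDiv α Q P) := by
    rw [discrim] at hdiscrim
    have hmul : α ^ 2 * Δ ^ 2 ≤ α ^ 2 * (c ^ 2 * (2 / α * renyiDiv α Q P)) := by
      have : α ^ 2 * (c ^ 2 * (2 / α * renyiDiv α Q P)) = 2 * α * c ^ 2 * renyiDiv α Q P := by
        field_simp
      linarith
    exact le_of_mul_le_mul_left hmul (by positivity)
  calc |Δ| ≤ Real.sqrt (c ^ 2 * (2 / α * renyiDiv α Q P)) := Real.abs_le_sqrt hsq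
    _ = c * Real.sqrt (2 / α * renyiDiv α Q P) := by
        rw [Real.sqrt_mul (sq_nonneg c), Real.sqrt_sq hc0]
end

section
/- Let P and Q be mutually absolutely continuous probability measures on a measurable space and let f be a bounded measurable real-valued function. Then |E_Q(f) − E_P(f)| ≤ ‖f‖_∞ · (2 − e^{−R(Q‖P)}), where R(Q‖P) is the relative entropy. (Scheffé-type complementary bound to the Pinsker inequality.) -/
open MeasureTheory

/-- A tangent-line form of `e ^ (-l / 2) = √(min 1 (e ^ (-l)) * max 1 (e ^ (-l)))`, combined with
the weighted AM-GM inequality. -/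
lemma exp_tangent_le_min_max (R l : ℝ) :
    Real.exp (-R / 2) * (1 + R / 2 - l / 2) ≤
      min 1 (Real.exp (-l)) / Real.exp (-R / 2) +
        Real.exp (-R / 2) / 4 * max 1 (Real.exp (-l)) := by
  set a := Real.exp (-R / 2) with ha
  have ha0 : 0 < a := Real.exp_pos _
  set s := Real.exp (-l / 2) with hs
  have hs0 : 0 < s := Real.exp_pos _
  have hs2 : Real.exp (-l) = s * s := by rw [hs, ← Real.exp_add]; congr 1; ring
  have h_tan : a * (1 + R / 2 - l / 2) ≤ s := by
    have h := Real.add_one_le_exp (R / 2 - l / 2)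
    have h' : s = a * Real.exp (R / 2 - l / 2) := by
      rw [hs, ha, ← Real.exp_add]; congr 1; ring
    rw [h']
    exact mul_le_mul_of_nonneg_left (by linarith) ha0.le
  refine h_tan.trans ?_
  rw [hs2, div_add' _ _ _ ha0.ne', le_div_iff₀ ha0]
  rcases le_total 1 (s * s) with h | h
  · rw [min_eq_left h, max_eq_right h]
    nlinarith [sq_nonneg (s * a - 2)]
  · rw [min_eq_right h, max_eq_left h]
    nlinarith [sq_nonneg (2 * s - a)]

/-- The Bretagnolle–Huber inequality for the `L¹` distance between `P` and `Q`. -/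
lemma integral_abs_one_sub_rnDeriv_le {Ω : Type*} [MeasurableSpace Ω] (P Q : Measure Ω)
    [IsProbabilityMeasure P] [IsProbabilityMeasure Q] (hQP : Q ≪ P) (hPQ : P ≪ Q)
    (hR : Integrable (fun x => Real.log ((Q.rnDeriv P x).toReal)) Q) :
    ∫ x, |1 - (P.rnDeriv Q x).toReal| ∂Q ≤ 2 - Real.exp (-relEnt Q P) := by
  set p : Ω → ℝ := fun x => (P.rnDeriv Q x).toReal with hp
  have hp_int : Integrable p Q := Measure.integrable_toReal_rnDeriv
  have hp_one : ∫ x, p x ∂Q = 1 := by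
    rw [hp, Measure.integral_toReal_rnDeriv hPQ]; simp
  have h_exp : ∀ᵐ x ∂Q, Real.exp (-Real.log ((Q.rnDeriv P x).toReal)) = p x :=
    exp_neg_llr hQP
  have h_min : Integrable (fun x => min 1 (p x)) Q := (integrable_const 1).inf hp_int
  have h_max : Integrable (fun x => max 1 (p x)) Q := (integrable_const 1).sup hp_int
  set a := Real.exp (-relEnt Q P / 2) with ha
  have ha0 : 0 < a := Real.exp_pos _
  have ha2 : Real.exp (-relEnt Q P) = a * a := by rw [ha, ← Real.exp_add]; congr 1; ring
  have h_jensen : a ≤ (∫ x, min 1 (p x) ∂Q) / a + a / 4 * ∫ x, max 1 (p x) ∂Q := by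
    calc a = ∫ x, a * (1 + relEnt Q P / 2 - Real.log ((Q.rnDeriv P x).toReal) / 2) ∂Q := by
          rw [integral_const_mul, integral_sub (integrable_const _) (hR.div_const 2),
            integral_div, ← relEnt]
          simp
      _ ≤ ∫ x, (min 1 (p x) / a + a / 4 * max 1 (p x)) ∂Q := by
          refine integral_mono_ae (((integrable_const _).sub (hR.div_const 2)).const_mul a)
            ((h_min.div_const a).add (h_max.const_mul _)) ?_
          filter_upwards [h_exp] with x hx
          simpa only [hx] using
            exp_tangent_le_min_max (relEnt Q P) (Real.log ((Q.rnDeriv P x).toReal))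
      _ = _ := by
          rw [integral_add (h_min.div_const a) (h_max.const_mul _), integral_div,
            integral_const_mul]
  have h_sum : (∫ x, min 1 (p x) ∂Q) + ∫ x, max 1 (p x) ∂Q = 2 := by
    rw [← integral_add h_min h_max]
    simp only [min_add_max]
    rw [integral_add (integrable_const _) hp_int, hp_one]
    norm_num
  have h_abs : ∫ x, |1 - p x| ∂Q = (∫ x, max 1 (p x) ∂Q) - ∫ x, min 1 (p x) ∂Q := by
    rw [← integral_sub h_max h_min]
    simp only [max_sub_min_eq_abs', hp]
  have h_nonneg : 0 ≤ ∫ x, min 1 (p x) ∂Q :=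
    integral_nonneg fun x => le_min zero_le_one ENNReal.toReal_nonneg
  rw [h_abs, ha2]
  rw [div_add' _ _ _ ha0.ne', le_div_iff₀ ha0] at h_jensen
  nlinarith [mul_nonneg h_nonneg (mul_pos ha0 ha0).le]

/-- Scheffé-type complementary bound to the Pinsker inequality. -/
theorem stmt_2 {Ω : Type*} [MeasurableSpace Ω] (P Q : Measure Ω)
    [IsProbabilityMeasure P] [IsProbabilityMeasure Q]
    (hQP : Q ≪ P) (hPQ : P ≪ Q)
    (f : Ω → ℝ) (hf : Measurable f) (C : ℝ) (hbdd : ∀ x, |f x| ≤ C)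
    (hR : Integrable (fun x => Real.log ((Q.rnDeriv P x).toReal)) Q) :
    |(∫ x, f x ∂Q) - ∫ x, f x ∂P| ≤
      essSup (fun x => |f x|) P * (2 - Real.exp (- relEnt Q P)) := by
  set M := essSup (fun x => |f x|) P
  have hM : ∀ᵐ x ∂P, |f x| ≤ M :=
    ae_le_essSup (Filter.isBoundedUnder_of ⟨C, hbdd⟩)
  have hM0 : 0 ≤ M := by
    obtain ⟨x, hx⟩ := hM.exists
    exact (abs_nonneg _).trans hx
  have hp_int : Integrable (fun x => (P.rnDeriv Q x).toReal) Q :=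
    Measure.integrable_toReal_rnDeriv
  have hf_int : Integrable f Q :=
    Integrable.of_bound hf.aestronglyMeasurable C (ae_of_all _ hbdd)
  have hpf_int : Integrable (fun x => (P.rnDeriv Q x).toReal * f x) Q :=
    hp_int.mul_bdd hf.aestronglyMeasurable (ae_of_all _ hbdd)
  have h_diff : (∫ x, f x ∂Q) - ∫ x, f x ∂P = ∫ x, (1 - (P.rnDeriv Q x).toReal) * f x ∂Q := by
    rw [← integral_rnDeriv_smul hPQ]
    simp only [smul_eq_mul]
    rw [← integral_sub hf_int hpf_int]
    simp only [sub_mul, one_mul]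
  calc |(∫ x, f x ∂Q) - ∫ x, f x ∂P|
      ≤ ∫ x, M * |1 - (P.rnDeriv Q x).toReal| ∂Q := by
        rw [h_diff, ← Real.norm_eq_abs]
        refine norm_integral_le_of_norm_le
          (((integrable_const 1).sub hp_int).abs.const_mul M) ?_
        filter_upwards [hQP.ae_le hM] with x hx
        rw [Real.norm_eq_abs, abs_mul, mul_comm]
        exact mul_le_mul_of_nonneg_right hx (abs_nonneg _)
    _ = M * ∫ x, |1 - (P.rnDeriv Q x).toReal| ∂Q := integral_const_mul _ _
    _ ≤ M * (2 - Real.exp (-relEnt Q P)) :=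
        mul_le_mul_of_nonneg_left (integral_abs_one_sub_rnDeriv_le P Q hQP hPQ hR) hM0
end

section
/- Let p and q be transition matrices of two irreducible Markov chains on a finite state space S, with stationary distributions μ_p and μ_q respectively, and assume p(x,·) and q(x,·) are mutually absolutely continuous for each x ∈ S, as are the initial distributions ν_p and ν_q. Let P_N and Q_N denote the laws of the length-N paths of the two chains. Then the limit lim_{N→∞} (1/N) R(Q_N‖P_N) exists and equals the relative entropy rate r(q‖p) := Σ_{x,y} μ_q(x) q(x,y) log( q(x,y)/p(x,y) ); moreover r(q‖p) ≥ 0 with equality if and only if p = q. -/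
open Finset Filter

/-- Law of the length-`N` path (`N` transitions, so `N+1` states) of a Markov chain with
transition matrix `p` and initial distribution `ν`:
`P_N(x₀,…,x_N) = ν(x₀) p(x₀,x₁) ⋯ p(x_{N−1},x_N)`. -/
noncomputable def pathLaw {S : Type*} [Fintype S] (p : Matrix S S ℝ) (ν : S → ℝ)
    (N : ℕ) (ω : Fin (N + 1) → S) : ℝ :=
  ν (ω 0) * ∏ k : Fin N, p (ω k.castSucc) (ω k.succ)

open Matrix

section PathLaw

variable {S : Type*} [Fintype S]

theorem pathLaw_snoc (p : Matrix S S ℝ) (ν : S → ℝ) (N : ℕ) (ω : Fin (N + 1) → S) (y : S) :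
    pathLaw p ν (N + 1) (Fin.snoc (α := fun _ => S) ω y) =
      pathLaw p ν N ω * p (ω (Fin.last N)) y := by
  have h0 : (Fin.snoc (α := fun _ => S) ω y : Fin (N + 1 + 1) → S) 0 = ω 0 :=
    Fin.snoc_castSucc (α := fun _ => S) y ω 0
  unfold pathLaw
  rw [Fin.prod_univ_castSucc, h0, mul_assoc]
  simp only [Fin.succ_castSucc, Fin.succ_last, Fin.snoc_castSucc, Fin.snoc_last]

theorem sum_path_succ (N : ℕ) (F : (Fin (N + 1 + 1) → S) → ℝ) :
    ∑ ω, F ω = ∑ ω : Fin (N + 1) → S, ∑ y, F (Fin.snoc (α := fun _ => S) ω y) := by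
  rw [← (Fin.snocEquiv fun _ : Fin (N + 1 + 1) => S).sum_comp, Fintype.sum_prod_type_right]
  rfl

theorem pathLaw_eq_zero_iff_of_ac {p q : Matrix S S ℝ} {νp νq : S → ℝ}
    (hrows : ∀ x y, p x y = 0 ↔ q x y = 0) (hν : ∀ x, νp x = 0 ↔ νq x = 0)
    (N : ℕ) (ω : Fin (N + 1) → S) : pathLaw p νp N ω = 0 ↔ pathLaw q νq N ω = 0 := by
  simp only [pathLaw, mul_eq_zero, Finset.prod_eq_zero_iff, hrows, hν]

/-- The last state of a path is distributed according to `ν q ^ N`. -/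
theorem sum_pathLaw_mul_last [DecidableEq S] (q : Matrix S S ℝ) (ν : S → ℝ) (N : ℕ) (g : S → ℝ) :
    ∑ ω : Fin (N + 1) → S, pathLaw q ν N ω * g (ω (Fin.last N)) = (ν ᵥ* q ^ N) ⬝ᵥ g := by
  induction N generalizing g with
  | zero =>
    rw [← (Equiv.funUnique (Fin 1) S).symm.sum_comp]
    simp [pathLaw, dotProduct]
  | succ N ih =>
    rw [sum_path_succ]
    simp only [pathLaw_snoc, Fin.snoc_last, mul_assoc, ← Finset.mul_sum]
    rw [ih fun x => ∑ y, q x y * g y, pow_succ, ← vecMul_vecMul, ← dotProduct_mulVec (_ ᵥ* _)]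
    rfl

/-- Relative entropy of the path laws. -/
theorem sum_pathLaw_log_div [DecidableEq S] {p q : Matrix S S ℝ} {νp νq : S → ℝ}
    (hq1 : ∀ x, ∑ y, q x y = 1)
    (hrows : ∀ x y, p x y = 0 ↔ q x y = 0) (hν : ∀ x, νp x = 0 ↔ νq x = 0) (N : ℕ) :
    ∑ ω : Fin (N + 1) → S,
        pathLaw q νq N ω * Real.log (pathLaw q νq N ω / pathLaw p νp N ω) =
      ∑ x, νq x * Real.log (νq x / νp x) +
        ∑ k ∈ range N, (νq ᵥ* q ^ k) ⬝ᵥ fun x => ∑ y, q x y * Real.log (q x y / p x y) := by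
  induction N with
  | zero =>
    rw [← (Equiv.funUnique (Fin 1) S).symm.sum_comp]
    simp [pathLaw]
  | succ N ih =>
    rw [sum_path_succ, Finset.sum_range_succ, ← add_assoc, ← ih, ← sum_pathLaw_mul_last,
      ← Finset.sum_add_distrib]
    refine Finset.sum_congr rfl fun ω _ => ?_
    have hterm : ∀ y, pathLaw q νq (N + 1) (Fin.snoc (α := fun _ => S) ω y) *
        Real.log (pathLaw q νq (N + 1) (Fin.snoc (α := fun _ => S) ω y) /
          pathLaw p νp (N + 1) (Fin.snoc (α := fun _ => S) ω y)) =
        q (ω (Fin.last N)) y *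
          (pathLaw q νq N ω * Real.log (pathLaw q νq N ω / pathLaw p νp N ω)) +
        pathLaw q νq N ω * (q (ω (Fin.last N)) y *
          Real.log (q (ω (Fin.last N)) y / p (ω (Fin.last N)) y)) := by
      intro y
      rw [pathLaw_snoc, pathLaw_snoc]
      by_cases hQ : pathLaw q νq N ω = 0
      · simp [hQ]
      by_cases hy : q (ω (Fin.last N)) y = 0
      · simp [hy]
      have hP := (pathLaw_eq_zero_iff_of_ac hrows hν N ω).not.mpr hQ
      have hpy := (hrows _ _).not.mpr hy
      rw [mul_div_mul_comm, Real.log_mul (div_ne_zero hQ hP) (div_ne_zero hy hpy)]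
      ring
    simp only [hterm, Finset.sum_add_distrib, ← Finset.sum_mul, ← Finset.mul_sum, hq1, one_mul]

end PathLaw

theorem vecMul_mem_stdSimplex {S : Type*} [Fintype S] {q : Matrix S S ℝ} (hq0 : ∀ x y, 0 ≤ q x y)
    (hq1 : ∀ x, ∑ y, q x y = 1) {ν : S → ℝ} (hν : ν ∈ stdSimplex ℝ S) :
    ν ᵥ* q ∈ stdSimplex ℝ S := by
  refine ⟨fun y => Finset.sum_nonneg fun x _ => mul_nonneg (hν.1 x) (hq0 x y), ?_⟩
  simp only [vecMul, dotProduct]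
  rw [Finset.sum_comm]
  simp only [← Finset.mul_sum, hq1, mul_one, hν.2]

section Stationary

variable {S : Type*} [Fintype S] [DecidableEq S]

theorem vecMul_pow_of_stationary {q : Matrix S S ℝ} {d : S → ℝ} (hd : d ᵥ* q = d) (n : ℕ) :
    d ᵥ* q ^ n = d := by
  induction n with
  | zero => simp
  | succ n ih => rw [pow_succ, ← vecMul_vecMul, ih, hd]

/-- A nonnegative invariant vector of an irreducible matrix that vanishes somewhere is zero. -/
theorem eq_zero_of_stationary_of_apply_eq_zero {q : Matrix S S ℝ} (hq0 : ∀ x y, 0 ≤ q x y)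
    (hqirr : ∀ x y, ∃ n : ℕ, 0 < (q ^ n) x y) {d : S → ℝ} (hd0 : ∀ x, 0 ≤ d x)
    (hd : d ᵥ* q = d) {x : S} (hx : d x = 0) : d = 0 := by
  funext y
  obtain ⟨n, hn⟩ := hqirr y x
  have hsum : ∑ z, d z * (q ^ n) z x = 0 := by
    rw [← hx]
    exact congrFun (vecMul_pow_of_stationary hd n) x
  have hpow := pow_apply_nonneg hq0 n
  have hy := (Finset.sum_eq_zero_iff_of_nonneg fun z _ => mul_nonneg (hd0 z) (hpow z x)).mp hsum y
    (Finset.mem_univ y)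
  exact (mul_eq_zero.mp hy).resolve_right hn.ne'

theorem stationary_pos {q : Matrix S S ℝ} (hq0 : ∀ x y, 0 ≤ q x y)
    (hqirr : ∀ x y, ∃ n : ℕ, 0 < (q ^ n) x y) {μ : S → ℝ} (hμ : μ ∈ stdSimplex ℝ S)
    (hstat : μ ᵥ* q = μ) (x : S) : 0 < μ x := by
  refine (hμ.1 x).lt_of_ne fun hx => ?_
  have := hμ.2
  simp [eq_zero_of_stationary_of_apply_eq_zero hq0 hqirr hμ.1 hstat hx.symm] at this

/-- The stationary distribution of an irreducible matrix is unique. -/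
theorem stationary_unique [Nonempty S] {q : Matrix S S ℝ} (hq0 : ∀ x y, 0 ≤ q x y)
    (hqirr : ∀ x y, ∃ n : ℕ, 0 < (q ^ n) x y) {μ c : S → ℝ} (hμ : μ ∈ stdSimplex ℝ S)
    (hμstat : μ ᵥ* q = μ) (hc : c ∈ stdSimplex ℝ S) (hcstat : c ᵥ* q = c) : c = μ := by
  have hpos := stationary_pos hq0 hqirr hμ hμstat
  obtain ⟨x, hx⟩ := Finite.exists_min fun x => c x / μ x
  set t := c x / μ x
  have hzero : c - t • μ = 0 := by
    refine eq_zero_of_stationary_of_apply_eq_zero hq0 hqirr (x := x) (fun y => ?_) ?_ ?_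
    · have := (le_div_iff₀ (hpos y)).mp (hx y)
      simpa using this
    · rw [sub_vecMul, smul_vecMul, hcstat, hμstat]
    · simp [t, (hpos x).ne']
  have hct : c = t • μ := sub_eq_zero.mp hzero
  have hsum := hc.2
  simp only [hct, Pi.smul_apply, smul_eq_mul, ← Finset.mul_sum, hμ.2, mul_one] at hsum
  rw [hct, hsum, one_smul]

theorem vecMul_pow_mem_stdSimplex {q : Matrix S S ℝ} (hq0 : ∀ x y, 0 ≤ q x y)
    (hq1 : ∀ x, ∑ y, q x y = 1) {ν : S → ℝ} (hν : ν ∈ stdSimplex ℝ S) (k : ℕ) :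
    ν ᵥ* q ^ k ∈ stdSimplex ℝ S := by
  induction k with
  | zero => simpa using hν
  | succ k ih =>
    rw [pow_succ, ← vecMul_vecMul]
    exact vecMul_mem_stdSimplex hq0 hq1 ih

/-- Mean ergodic theorem for irreducible finite Markov chains. -/
theorem tendsto_average_vecMul_pow [Nonempty S] {q : Matrix S S ℝ} (hq0 : ∀ x y, 0 ≤ q x y)
    (hq1 : ∀ x, ∑ y, q x y = 1) (hqirr : ∀ x y, ∃ n : ℕ, 0 < (q ^ n) x y) {ν μ : S → ℝ}
    (hν : ν ∈ stdSimplex ℝ S) (hμ : μ ∈ stdSimplex ℝ S) (hμstat : μ ᵥ* q = μ) :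
    Tendsto (fun N : ℕ => (N : ℝ)⁻¹ • ∑ k ∈ range N, ν ᵥ* q ^ k) atTop (nhds μ) := by
  set a : ℕ → S → ℝ := fun N => (N : ℝ)⁻¹ • ∑ k ∈ range N, ν ᵥ* q ^ k with ha
  have hK : IsCompact (stdSimplex ℝ S) := isCompact_stdSimplex ℝ S
  have hmem := vecMul_pow_mem_stdSimplex hq0 hq1 hν
  have haK : ∀ᶠ N in atTop, a N ∈ stdSimplex ℝ S := by
    filter_upwards [eventually_gt_atTop 0] with N hN
    have hN' : (0 : ℝ) < N := by exact_mod_cast hN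
    simp only [ha, Finset.smul_sum]
    refine (convex_stdSimplex ℝ S).sum_mem (fun _ _ => by positivity) ?_ fun k _ => hmem k
    simp [hN'.ne']
  have hdiff : Tendsto (fun N => a N ᵥ* q - a N) atTop (nhds 0) := by
    have heq : ∀ N, a N ᵥ* q - a N = (N : ℝ)⁻¹ • (ν ᵥ* q ^ N - ν) := by
      intro N
      have htel := Finset.sum_range_sub (fun k => ν ᵥ* q ^ k) N
      rw [pow_zero, vecMul_one] at htel
      rw [← htel, ha, smul_vecMul, ← smul_sub, sum_vecMul, ← Finset.sum_sub_distrib]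
      simp only [pow_succ, vecMul_vecMul]
    simp only [heq]
    refine tendsto_inv_atTop_nhds_zero_nat.zero_smul_isBoundedUnder_le ?_
    obtain ⟨C, hC⟩ := hK.isBounded.exists_norm_le
    refine isBoundedUnder_of ⟨C + C, fun N => ?_⟩
    exact (norm_sub_le _ _).trans (add_le_add (hC _ (hmem N)) (hC _ hν))
  refine hK.tendsto_nhds_of_unique_mapClusterPt haK fun c hc hcl => ?_
  refine stationary_unique hq0 hqirr hμ hμstat hc ?_
  have hcont : Continuous fun v : S → ℝ => v ᵥ* q - v := by fun_prop
  have hcl' : MapClusterPt (c ᵥ* q - c) atTop fun N => a N ᵥ* q - a N :=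
    hcl.continuousAt_comp hcont.continuousAt
  exact sub_eq_zero.mp (eq_of_nhds_neBot (hcl'.clusterPt.mono hdiff))

end Stationary

theorem sub_lt_mul_log_div {a b : ℝ} (ha : 0 ≤ a) (hb : 0 ≤ b) (hab : b = 0 ↔ a = 0)
    (hne : b ≠ a) : a - b < a * Real.log (a / b) := by
  have ha' : 0 < a := ha.lt_of_ne fun h => hne ((hab.mpr h.symm).trans h)
  have hb' : 0 < b := hb.lt_of_ne fun h => ha'.ne' (hab.mp h.symm)
  have hlog := Real.log_lt_sub_one_of_pos (div_pos hb' ha')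
    fun h => hne ((div_eq_one_iff_eq ha'.ne').mp h)
  have hmul := mul_lt_mul_of_pos_left hlog ha'
  rw [← inv_div, Real.log_inv]
  have : a * (b / a - 1) = b - a := by field_simp
  linarith

theorem sub_le_mul_log_div {a b : ℝ} (ha : 0 ≤ a) (hb : 0 ≤ b) (hab : b = 0 ↔ a = 0) :
    a - b ≤ a * Real.log (a / b) := by
  rcases eq_or_ne b a with rfl | hne
  · rcases eq_or_ne b 0 with rfl | h <;> simp [*]
  · exact (sub_lt_mul_log_div ha hb hab hne).le

/-- The relative entropy per unit time of the path measures of two irreducible Markov chains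
converges to the relative entropy rate
`r(q‖p) = Σ_{x,y} μ_q(x) q(x,y) log(q(x,y)/p(x,y))`, which is nonnegative and vanishes
if and only if `p = q`. -/
theorem stmt_10 {S : Type*} [Fintype S] [DecidableEq S] [Nonempty S]
    (p q : Matrix S S ℝ) (νp νq μp μq : S → ℝ)
    (hp0 : ∀ x y, 0 ≤ p x y) (hp1 : ∀ x, ∑ y, p x y = 1)
    (hq0 : ∀ x y, 0 ≤ q x y) (hq1 : ∀ x, ∑ y, q x y = 1)
    (hpirr : ∀ x y, ∃ n : ℕ, 0 < (p ^ n) x y)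
    (hqirr : ∀ x y, ∃ n : ℕ, 0 < (q ^ n) x y)
    (hrows : ∀ x y, p x y = 0 ↔ q x y = 0)
    (hνp0 : ∀ x, 0 ≤ νp x) (hνp1 : ∑ x, νp x = 1)
    (hνq0 : ∀ x, 0 ≤ νq x) (hνq1 : ∑ x, νq x = 1)
    (hνac : ∀ x, νp x = 0 ↔ νq x = 0)
    (hμp0 : ∀ x, 0 ≤ μp x) (hμp1 : ∑ x, μp x = 1)
    (hμpstat : ∀ y, ∑ x, μp x * p x y = μp y)
    (hμq0 : ∀ x, 0 ≤ μq x) (hμq1 : ∑ x, μq x = 1)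
    (hμqstat : ∀ y, ∑ x, μq x * q x y = μq y) :
    Tendsto (fun N : ℕ =>
        (1 / (N : ℝ)) * ∑ ω : Fin (N + 1) → S,
          pathLaw q νq N ω * Real.log (pathLaw q νq N ω / pathLaw p νp N ω))
      atTop (nhds (∑ x, ∑ y, μq x * q x y * Real.log (q x y / p x y)))
    ∧ 0 ≤ ∑ x, ∑ y, μq x * q x y * Real.log (q x y / p x y)
    ∧ ((∑ x, ∑ y, μq x * q x y * Real.log (q x y / p x y)) = 0 ↔ p = q) := by
  have hνq : νq ∈ stdSimplex ℝ S := ⟨hνq0, hνq1⟩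
  have hμq : μq ∈ stdSimplex ℝ S := ⟨hμq0, hμq1⟩
  have hstat : μq ᵥ* q = μq := funext hμqstat
  have hpos := stationary_pos hq0 hqirr hμq hstat
  have hterm : ∀ x y, 0 ≤ μq x * (q x y * Real.log (q x y / p x y) - (q x y - p x y)) :=
    fun x y => mul_nonneg (hμq0 x)
      (sub_nonneg.mpr (sub_le_mul_log_div (hq0 x y) (hp0 x y) (hrows x y)))
  have hrate : ∑ x, ∑ y, μq x * q x y * Real.log (q x y / p x y) =
      ∑ x, ∑ y, μq x * (q x y * Real.log (q x y / p x y) - (q x y - p x y)) := by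
    simp only [mul_assoc, ← Finset.mul_sum, Finset.sum_sub_distrib, hp1, hq1, sub_self, sub_zero]
  refine ⟨?_, ?_, ?_⟩
  · set h : S → ℝ := fun x => ∑ y, q x y * Real.log (q x y / p x y) with hh
    have hlim : ∑ x, ∑ y, μq x * q x y * Real.log (q x y / p x y) = μq ⬝ᵥ h := by
      simp only [hh, dotProduct, Finset.mul_sum, mul_assoc]
    have hcont : Continuous fun v : S → ℝ => v ⬝ᵥ h := by fun_prop
    have hav := (hcont.tendsto μq).comp (tendsto_average_vecMul_pow hq0 hq1 hqirr hνq hμq hstat)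
    have hinit := (tendsto_inv_atTop_nhds_zero_nat (𝕜 := ℝ)).mul_const
      (∑ x, νq x * Real.log (νq x / νp x))
    have hsum := hinit.add hav
    rw [zero_mul, zero_add] at hsum
    rw [hlim]
    refine hsum.congr fun N => ?_
    rw [sum_pathLaw_log_div hq1 hrows hνac, one_div, mul_add]
    simp only [Function.comp_apply, smul_dotProduct, sum_dotProduct, smul_eq_mul, hh]
  · rw [hrate]
    exact Finset.sum_nonneg fun x _ => Finset.sum_nonneg fun y _ => hterm x y
  · constructor
    · intro hzero
      rw [hrate, Finset.sum_eq_zero_iff_of_nonneg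
        fun x _ => Finset.sum_nonneg fun y _ => hterm x y] at hzero
      ext x y
      by_contra hne
      have hxy := (Finset.sum_eq_zero_iff_of_nonneg fun y _ => hterm x y).mp
        (hzero x (Finset.mem_univ x)) y (Finset.mem_univ y)
      have hlt := sub_lt_mul_log_div (hq0 x y) (hp0 x y) (hrows x y) hne
      exact (mul_pos (hpos x) (sub_pos.mpr hlt)).ne' hxy
    · rintro rfl
      refine Finset.sum_eq_zero fun x _ => Finset.sum_eq_zero fun y _ => ?_
      rcases eq_or_ne (p x y) 0 with h | h <;> simp [h]
end

section
/- Let p and q be transition matrices of two irreducible Markov chains on a finite state space S, with p(x,·) and q(x,·) mutually absolutely continuous for each x, and with mutually absolutely continuous initial distributions; let P_N, Q_N denote the path laws, and let α > 0, α ≠ 1. Then lim_{N→∞} (1/N) D_α(Q_N‖P_N) = (1/(α−1)) log ρ(α), where ρ(α) is the maximal (Perron–Frobenius) eigenvalue of the irreducible nonnegative matrix with entries q(x,y)^α p(x,y)^{1−α}; moreover (1/(α−1)) log ρ(α) ≥ 0 with equality if and only if p = q. -/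
open Finset Filter

theorem sum_pathLaw_mul_eigenvector {S : Type*} [Fintype S] {M : Matrix S S ℝ} {ρ : ℝ}
    {v : S → ℝ} (heig : ∀ x, ∑ y, M x y * v y = ρ * v x) (N : ℕ) (a : S → ℝ) :
    ∑ ω : Fin (N + 1) → S, pathLaw M a N ω * v (ω (Fin.last N)) = ρ ^ N * ∑ x, a x * v x := by
  induction N generalizing a with
  | zero =>
    rw [← (Equiv.funUnique (Fin 1) S).symm.sum_comp]
    simp [pathLaw]
  | succ N ih =>
    have hcons (x : S) (ω : Fin (N + 1) → S) :
        pathLaw M a (N + 1) (Fin.consEquiv (fun _ : Fin (N + 1 + 1) => S) (x, ω))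
          = pathLaw M (fun y => a x * M x y) N ω := by
      simp [pathLaw, Fin.prod_univ_succ, mul_assoc]
    rw [← (Fin.consEquiv fun _ : Fin (N + 1 + 1) => S).sum_comp, Fintype.sum_prod_type]
    have hlast (x : S) (ω : Fin (N + 1) → S) :
        Fin.consEquiv (fun _ : Fin (N + 1 + 1) => S) (x, ω) (Fin.last (N + 1))
          = ω (Fin.last N) := by
      rw [Fin.consEquiv_apply, ← Fin.succ_last, Fin.cons_succ]
    simp only [hcons, hlast, ih]
    rw [← Finset.mul_sum, pow_succ, mul_assoc, Finset.mul_sum (a := ρ)]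
    congr 1
    refine Finset.sum_congr rfl fun x _ => ?_
    simp only [mul_assoc, ← Finset.mul_sum, heig]
    ring

theorem pathLaw_nonneg {S : Type*} [Fintype S] {M : Matrix S S ℝ} {a : S → ℝ}
    (hM : ∀ x y, 0 ≤ M x y) (ha : ∀ x, 0 ≤ a x) (N : ℕ) (ω : Fin (N + 1) → S) :
    0 ≤ pathLaw M a N ω :=
  mul_nonneg (ha _) (Finset.prod_nonneg fun _ _ => hM _ _)

theorem pathLaw_rpow_mul_rpow {S : Type*} [Fintype S] {p q : Matrix S S ℝ} {νp νq : S → ℝ}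
    (hp0 : ∀ x y, 0 ≤ p x y) (hq0 : ∀ x y, 0 ≤ q x y)
    (hνp0 : ∀ x, 0 ≤ νp x) (hνq0 : ∀ x, 0 ≤ νq x) (a b : ℝ) (N : ℕ) (ω : Fin (N + 1) → S) :
    pathLaw q νq N ω ^ a * pathLaw p νp N ω ^ b
      = pathLaw (fun x y => q x y ^ a * p x y ^ b) (fun x => νq x ^ a * νp x ^ b) N ω := by
  unfold pathLaw
  rw [Real.mul_rpow (hνq0 _) (Finset.prod_nonneg fun _ _ => hq0 _ _),
    Real.mul_rpow (hνp0 _) (Finset.prod_nonneg fun _ _ => hp0 _ _),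
    ← Real.finsetProd_rpow _ _ fun _ _ => hq0 _ _, ← Real.finsetProd_rpow _ _ fun _ _ => hp0 _ _,
    Finset.prod_mul_distrib]
  ring

/-- A sequence comparable to `ρ ^ N` has exponential growth rate `log ρ`. -/
theorem tendsto_one_div_mul_log_of_pow_bounds {Z : ℕ → ℝ} {ρ c C : ℝ} (hρ : 0 < ρ) (hc : 0 < c)
    (hl : ∀ N, c * ρ ^ N ≤ Z N) (hu : ∀ N, Z N ≤ C * ρ ^ N) :
    Tendsto (fun N : ℕ => (1 / (N : ℝ)) * Real.log (Z N)) atTop (nhds (Real.log ρ)) := by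
  have hC : 0 < C := by
    have := (hl 0).trans (hu 0)
    simp only [pow_zero, mul_one] at this
    linarith
  have hlim (K : ℝ) :
      Tendsto (fun N : ℕ => Real.log K / N + Real.log ρ) atTop (nhds (Real.log ρ)) := by
    simpa using (tendsto_const_div_atTop_nhds_zero_nat (Real.log K)).add_const (Real.log ρ)
  have hlog {K : ℝ} (hK : 0 < K) {N : ℕ} (hN : 0 < N) :
      Real.log K / N + Real.log ρ = (1 / (N : ℝ)) * Real.log (K * ρ ^ N) := by
    have : (N : ℝ) ≠ 0 := by positivity
    rw [Real.log_mul hK.ne' (by positivity), Real.log_pow]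
    field_simp
  refine tendsto_of_tendsto_of_tendsto_of_le_of_le' (hlim c) (hlim C) ?_ ?_
  · filter_upwards [eventually_gt_atTop 0] with N hN
    rw [hlog hc hN]
    gcongr
    exact hl N
  · filter_upwards [eventually_gt_atTop 0] with N hN
    rw [hlog hC hN]
    have : 0 < Z N := lt_of_lt_of_le (by positivity) (hl N)
    gcongr
    exact hu N

theorem tendsto_log_sum_pathLaw {S : Type*} [Fintype S] [Nonempty S] {M : Matrix S S ℝ} {ρ : ℝ}
    {a v : S → ℝ} (hρ : 0 < ρ) (hM : ∀ x y, 0 ≤ M x y) (ha : ∀ x, 0 ≤ a x) (hapos : ∃ x, 0 < a x)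
    (hv : ∀ x, 0 < v x) (heig : ∀ x, ∑ y, M x y * v y = ρ * v x) :
    Tendsto (fun N : ℕ => (1 / (N : ℝ)) * Real.log (∑ ω : Fin (N + 1) → S, pathLaw M a N ω))
      atTop (nhds (Real.log ρ)) := by
  obtain ⟨x₀, hx₀⟩ := Finite.exists_min v
  obtain ⟨x₁, hx₁⟩ := Finite.exists_max v
  have hA : 0 < ∑ x, a x * v x := by
    obtain ⟨x, hx⟩ := hapos
    exact Finset.sum_pos' (fun y _ => mul_nonneg (ha y) (hv y).le)
      ⟨x, Finset.mem_univ x, mul_pos hx (hv x)⟩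
  have h0 := hv x₀
  have h1 := hv x₁
  refine tendsto_one_div_mul_log_of_pow_bounds (c := (∑ x, a x * v x) / v x₁)
    (C := (∑ x, a x * v x) / v x₀) hρ (by positivity) (fun N => ?_) fun N => ?_
  · rw [div_mul_eq_mul_div, div_le_iff₀ h1, mul_comm, ← sum_pathLaw_mul_eigenvector heig,
      Finset.sum_mul]
    gcongr with ω
    · exact pathLaw_nonneg hM ha N ω
    · exact hx₁ _
  · rw [div_mul_eq_mul_div, le_div_iff₀ h0, mul_comm (∑ x, a x * v x),
      ← sum_pathLaw_mul_eigenvector heig, Finset.sum_mul]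
    gcongr with ω
    · exact pathLaw_nonneg hM ha N ω
    · exact hx₀ _

/-- Strict Young inequality, valid on both sides of `α = 1`. -/
theorem young_gap_pos {α a b : ℝ} (hα0 : 0 < α) (hα1 : α ≠ 1) (ha : 0 < a) (hb : 0 < b)
    (hab : a ≠ b) : 0 < (α - 1)⁻¹ * (a ^ α * b ^ (1 - α) - (α * a + (1 - α) * b)) := by
  have hs : (-1 : ℝ) ≤ a / b - 1 := by
    have : 0 < a / b := by positivity
    linarith
  have hs0 : a / b - 1 ≠ 0 := by
    rwa [sub_ne_zero, ne_eq, div_eq_one_iff_eq hb.ne']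
  have hfac : a ^ α * b ^ (1 - α) - (α * a + (1 - α) * b)
      = b * ((1 + (a / b - 1)) ^ α - (1 + α * (a / b - 1))) := by
    rw [add_sub_cancel, Real.div_rpow ha.le hb.le, Real.rpow_sub hb, Real.rpow_one]
    have : b ^ α ≠ 0 := (Real.rpow_pos_of_pos hb α).ne'
    field_simp
    ring
  rw [hfac]
  rcases lt_or_gt_of_ne hα1 with h | h
  · have := rpow_one_add_lt_one_add_mul_self hs hs0 hα0 h
    exact mul_pos_of_neg_of_neg (inv_lt_zero.2 (by linarith))
      (mul_neg_of_pos_of_neg hb (by linarith))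
  · have := one_add_mul_self_lt_rpow_one_add hs hs0 h
    exact mul_pos (inv_pos.2 (by linarith)) (mul_pos hb (by linarith))

theorem rpow_mul_rpow_one_sub_self {α a : ℝ} (hα0 : α ≠ 0) (ha : 0 ≤ a) :
    a ^ α * a ^ (1 - α) = a := by
  rcases ha.eq_or_lt with rfl | ha
  · simp [Real.zero_rpow hα0]
  · rw [← Real.rpow_add ha, add_sub_cancel, Real.rpow_one]

theorem young_gap_nonneg {α a b : ℝ} (hα0 : 0 < α) (hα1 : α ≠ 1) (ha : 0 ≤ a) (hb : 0 ≤ b)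
    (hab : b = 0 ↔ a = 0) :
    0 ≤ (α - 1)⁻¹ * (a ^ α * b ^ (1 - α) - (α * a + (1 - α) * b)) ∧
      ((α - 1)⁻¹ * (a ^ α * b ^ (1 - α) - (α * a + (1 - α) * b)) = 0 → b = a) := by
  by_cases h : a = b
  · subst h
    rw [rpow_mul_rpow_one_sub_self hα0.ne' ha]
    exact ⟨le_of_eq (by ring), fun _ => rfl⟩
  · have ha' : a ≠ 0 := fun h0 => h (h0.trans (hab.2 h0).symm)
    have hb' : b ≠ 0 := fun h0 => ha' (hab.1 h0)
    have := young_gap_pos hα0 hα1 (ha.lt_of_ne' ha') (hb.lt_of_ne' hb') h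
    exact ⟨this.le, fun h0 => absurd h0 this.ne'⟩

theorem young_gap_row {S : Type*} [Fintype S] {p q : S → ℝ} {α : ℝ} (hα0 : 0 < α) (hα1 : α ≠ 1)
    (hp0 : ∀ y, 0 ≤ p y) (hp1 : ∑ y, p y = 1) (hq0 : ∀ y, 0 ≤ q y) (hq1 : ∑ y, q y = 1)
    (hpq : ∀ y, p y = 0 ↔ q y = 0) :
    0 ≤ (α - 1)⁻¹ * (∑ y, q y ^ α * p y ^ (1 - α) - 1) ∧
      ((α - 1)⁻¹ * (∑ y, q y ^ α * p y ^ (1 - α) - 1) = 0 → p = q) := by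
  have hsum : (α - 1)⁻¹ * (∑ y, q y ^ α * p y ^ (1 - α) - 1)
      = ∑ y, (α - 1)⁻¹ * (q y ^ α * p y ^ (1 - α) - (α * q y + (1 - α) * p y)) := by
    rw [← Finset.mul_sum, Finset.sum_sub_distrib, Finset.sum_add_distrib, ← Finset.mul_sum,
      ← Finset.mul_sum, hp1, hq1]
    ring
  have hgap y := young_gap_nonneg hα0 hα1 (hq0 y) (hp0 y) (hpq y)
  rw [hsum]
  refine ⟨Finset.sum_nonneg fun y _ => (hgap y).1, fun h => funext fun y => (hgap y).2 ?_⟩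
  exact (Finset.sum_eq_zero_iff_of_nonneg fun y _ => (hgap y).1).1 h y (Finset.mem_univ y)

/-- A set closed under the positive transitions of an irreducible matrix is everything. -/
theorem forall_of_irreducible {S : Type*} [Fintype S] [DecidableEq S] {p : Matrix S S ℝ}
    (hp0 : ∀ x y, 0 ≤ p x y) (hpirr : ∀ x y, ∃ n : ℕ, 0 < (p ^ n) x y) {A : S → Prop}
    (hstep : ∀ x y, A x → 0 < p x y → A y) {x : S} (hx : A x) (y : S) : A y := by
  have key (n : ℕ) : ∀ y, (p ^ n) x y ≠ 0 → A y := by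
    induction n with
    | zero =>
      intro y hy
      by_cases hxy : x = y
      · exact hxy ▸ hx
      · simp [Matrix.one_apply_ne hxy] at hy
    | succ n ih =>
      intro y hy
      rw [pow_succ, Matrix.mul_apply] at hy
      obtain ⟨z, -, hz⟩ := Finset.exists_ne_zero_of_sum_ne_zero hy
      exact hstep z y (ih z (left_ne_zero_of_mul hz))
        ((hp0 z y).lt_of_ne' (right_ne_zero_of_mul hz))
  obtain ⟨n, hn⟩ := hpirr x y
  exact key n y hn.ne'

theorem eigenvalue_pos {S : Type*} [Fintype S] [Nonempty S] {M : Matrix S S ℝ} {ρ : ℝ} {v : S → ℝ}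
    (hM : ∀ x y, 0 ≤ M x y) (hMpos : ∃ x y, 0 < M x y) (hv : ∀ x, 0 < v x)
    (heig : ∀ x, ∑ y, M x y * v y = ρ * v x) : 0 < ρ := by
  obtain ⟨x, y, hxy⟩ := hMpos
  have : 0 < ρ * v x := by
    rw [← heig x]
    exact Finset.sum_pos' (fun y _ => mul_nonneg (hM x y) (hv y).le)
      ⟨y, Finset.mem_univ y, mul_pos hxy (hv y)⟩
  exact pos_of_mul_pos_left this (hv x).le

theorem eigenvalue_gap {S : Type*} [Fintype S] {M : Matrix S S ℝ} {ρ : ℝ} {v : S → ℝ}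
    (heig : ∀ x, ∑ y, M x y * v y = ρ * v x) (β : ℝ) (x : S) :
    β * (ρ - 1) * v x
      = ∑ y, M x y * (β * (v y - v x)) + β * (∑ y, M x y - 1) * v x := by
  have h : ∑ y, M x y * (β * (v y - v x)) = β * (∑ y, M x y * v y) - β * (∑ y, M x y) * v x := by
    rw [Finset.mul_sum, Finset.mul_sum, Finset.sum_mul, ← Finset.sum_sub_distrib]
    exact Finset.sum_congr rfl fun y _ => by ring
  rw [h, heig]
  ring

theorem exists_forall_mul_sub_nonneg {S : Type*} [Finite S] [Nonempty S] (v : S → ℝ) (β : ℝ) :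
    ∃ x, ∀ y, 0 ≤ β * (v y - v x) := by
  obtain ⟨x, hx⟩ := Finite.exists_min fun y => β * v y
  exact ⟨x, fun y => by linarith [hx y]⟩

theorem eigenvalue_eq_one_of_stochastic {S : Type*} [Fintype S] [Nonempty S] {M : Matrix S S ℝ}
    {ρ : ℝ} {v : S → ℝ} (hM : ∀ x y, 0 ≤ M x y) (hM1 : ∀ x, ∑ y, M x y = 1) (hv : ∀ x, 0 < v x)
    (heig : ∀ x, ∑ y, M x y * v y = ρ * v x) : ρ = 1 := by
  have key (β : ℝ) : 0 ≤ β * (ρ - 1) := by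
    obtain ⟨x, hx⟩ := exists_forall_mul_sub_nonneg v β
    have h := eigenvalue_gap heig β x
    rw [hM1, sub_self, mul_zero, zero_mul, add_zero] at h
    refine nonneg_of_mul_nonneg_left ?_ (hv x)
    rw [h]
    exact Finset.sum_nonneg fun y _ => mul_nonneg (hM x y) (hx y)
  linarith [key 1, key (-1)]

theorem mul_log_nonneg_of_mul_sub_one_nonneg {β ρ : ℝ} (hρ : 0 < ρ) (h : 0 ≤ β * (ρ - 1)) :
    0 ≤ β * Real.log ρ := by
  rcases lt_trichotomy ρ 1 with h1 | rfl | h1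
  · exact mul_nonneg_of_nonpos_of_nonpos
      (nonpos_of_mul_nonneg_left h (by linarith)) (Real.log_nonpos hρ.le h1.le)
  · simp
  · exact mul_nonneg (nonneg_of_mul_nonneg_left h (by linarith)) (Real.log_nonneg h1.le)

/-- The Rényi divergence per unit time of the path measures of two irreducible Markov chains
converges to `(1/(α−1)) log ρ(α)`, where `ρ(α)` is the Perron–Frobenius eigenvalue
(characterized as the eigenvalue with a positive eigenvector) of the irreducible nonnegative
matrix with entries `q(x,y)^α p(x,y)^{1−α}`; moreover `(1/(α−1)) log ρ(α) ≥ 0` with equality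
if and only if `p = q`. -/
theorem stmt_11 {S : Type*} [Fintype S] [DecidableEq S] [Nonempty S]
    (p q : Matrix S S ℝ) (νp νq : S → ℝ) (α : ℝ) (hα0 : 0 < α) (hα1 : α ≠ 1)
    (hp0 : ∀ x y, 0 ≤ p x y) (hp1 : ∀ x, ∑ y, p x y = 1)
    (hq0 : ∀ x y, 0 ≤ q x y) (hq1 : ∀ x, ∑ y, q x y = 1)
    (hpirr : ∀ x y, ∃ n : ℕ, 0 < (p ^ n) x y)
    (hqirr : ∀ x y, ∃ n : ℕ, 0 < (q ^ n) x y)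
    (hrows : ∀ x y, p x y = 0 ↔ q x y = 0)
    (hνp0 : ∀ x, 0 ≤ νp x) (hνp1 : ∑ x, νp x = 1)
    (hνq0 : ∀ x, 0 ≤ νq x) (hνq1 : ∑ x, νq x = 1)
    (hνac : ∀ x, νp x = 0 ↔ νq x = 0)
    (ρ : ℝ) (v : S → ℝ) (hv : ∀ x, 0 < v x)
    (heig : ∀ x, ∑ y, (q x y ^ α * p x y ^ (1 - α)) * v y = ρ * v x) :
    Tendsto (fun N : ℕ =>
        (1 / (N : ℝ)) * ((α - 1)⁻¹ *
          Real.log (∑ ω : Fin (N + 1) → S,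
            pathLaw q νq N ω ^ α * pathLaw p νp N ω ^ (1 - α))))
      atTop (nhds ((α - 1)⁻¹ * Real.log ρ))
    ∧ 0 ≤ (α - 1)⁻¹ * Real.log ρ
    ∧ ((α - 1)⁻¹ * Real.log ρ = 0 ↔ p = q) := by
  set M : Matrix S S ℝ := fun x y => q x y ^ α * p x y ^ (1 - α) with hMdef
  have hM : ∀ x y, 0 ≤ M x y := fun x y =>
    mul_nonneg (Real.rpow_nonneg (hq0 x y) _) (Real.rpow_nonneg (hp0 x y) _)
  have hMpos {x y : S} (hxy : 0 < p x y) : 0 < M x y :=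
    mul_pos (Real.rpow_pos_of_pos
      ((hq0 x y).lt_of_ne' fun h => hxy.ne' ((hrows x y).2 h)) _) (Real.rpow_pos_of_pos hxy _)
  have heigM : ∀ x, ∑ y, M x y * v y = ρ * v x := heig
  have hβ : (α - 1)⁻¹ ≠ 0 := inv_ne_zero (sub_ne_zero.2 hα1)
  have hρ : 0 < ρ := by
    obtain ⟨x⟩ := ‹Nonempty S›
    obtain ⟨y, -, hy⟩ := Finset.exists_ne_zero_of_sum_ne_zero ((hp1 x).trans_ne one_ne_zero)
    exact eigenvalue_pos hM ⟨x, y, hMpos ((hp0 x y).lt_of_ne' hy)⟩ hv heigM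
  have hrow x := young_gap_row hα0 hα1 (hp0 x) (hp1 x) (hq0 x) (hq1 x) (hrows x)
  obtain ⟨x₀, hx₀⟩ := exists_forall_mul_sub_nonneg v (α - 1)⁻¹
  refine ⟨?_, ?_, ?_, ?_⟩
  · simp only [pathLaw_rpow_mul_rpow hp0 hq0 hνp0 hνq0, mul_left_comm (1 / _ : ℝ)]
    refine (tendsto_log_sum_pathLaw hρ hM ?_ ?_ hv heigM).const_mul _
    · exact fun x => mul_nonneg (Real.rpow_nonneg (hνq0 x) _) (Real.rpow_nonneg (hνp0 x) _)
    · obtain ⟨x, -, hx⟩ := Finset.exists_ne_zero_of_sum_ne_zero (hνp1.trans_ne one_ne_zero)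
      exact ⟨x, mul_pos
        (Real.rpow_pos_of_pos ((hνq0 x).lt_of_ne' fun h => hx ((hνac x).2 h)) _)
        (Real.rpow_pos_of_pos ((hνp0 x).lt_of_ne' hx) _)⟩
  · refine mul_log_nonneg_of_mul_sub_one_nonneg hρ (nonneg_of_mul_nonneg_left ?_ (hv x₀))
    rw [eigenvalue_gap heigM]
    exact add_nonneg (Finset.sum_nonneg fun y _ => mul_nonneg (hM x₀ y) (hx₀ y))
      (mul_nonneg (hrow x₀).1 (hv x₀).le)
  · intro h
    have hρ1 : ρ = 1 := Real.eq_one_of_pos_of_log_eq_zero hρ ((mul_eq_zero_iff_left hβ).1 h)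
    have hzero (x : S) (hx : ∀ y, 0 ≤ (α - 1)⁻¹ * (v y - v x)) :
        (∀ y, M x y * ((α - 1)⁻¹ * (v y - v x)) = 0) ∧ p x = q x := by
      have hgap := eigenvalue_gap heigM (α - 1)⁻¹ x
      rw [hρ1, sub_self, mul_zero, zero_mul, eq_comm] at hgap
      have hnn : ∀ y ∈ Finset.univ, 0 ≤ M x y * ((α - 1)⁻¹ * (v y - v x)) :=
        fun y _ => mul_nonneg (hM x y) (hx y)
      obtain ⟨h1, h2⟩ := (add_eq_zero_iff_of_nonneg (Finset.sum_nonneg hnn)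
        (mul_nonneg (hrow x).1 (hv x).le)).1 hgap
      exact ⟨fun y => (Finset.sum_eq_zero_iff_of_nonneg hnn).1 h1 y (Finset.mem_univ y),
        (hrow x).2 ((mul_eq_zero_iff_right (hv x).ne').1 h2)⟩
    have hall : ∀ x, ∀ y, 0 ≤ (α - 1)⁻¹ * (v y - v x) := by
      refine forall_of_irreducible hp0 hpirr (fun x y hx hxy => ?_) hx₀
      have hvy : v y = v x := by
        have := (hzero x hx).1 y
        simpa [(hMpos hxy).ne', hβ, sub_eq_zero] using this
      rwa [hvy]
    exact funext fun x => (hzero x (hall x)).2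
  · rintro rfl
    have hMp : M = p := by
      ext x y
      exact rpow_mul_rpow_one_sub_self hα0.ne' (hp0 x y)
    rw [eigenvalue_eq_one_of_stochastic hM (by simpa only [hMp] using hp1) hv heigM,
      Real.log_one, mul_zero]
end

section
/- Let P and Q be probability measures with Q absolutely continuous with respect to P, and let f be a measurable real-valued function whose cumulant generating function Λ_{P,f}(c) = log E_P(e^{cf}) is finite for all c in a neighborhood (−c₀, c₀) of the origin. Then Ξ₋(Q‖P; f) ≤ E_Q(f) − E_P(f) ≤ Ξ₊(Q‖P; f), where Ξ₊(Q‖P; f) = inf_{c>0} { (1/c) Λ̃_{P,f}(c) + (1/c) R(Q‖P) } and Ξ₋(Q‖P; f) = sup_{c>0} { −(1/c) Λ̃_{P,f}(−c) − (1/c) R(Q‖P) }, with Λ̃_{P,f}(c) = log E_P( e^{c(f − E_P(f))} ). (Goal-oriented divergence uncertainty quantification bound.) -/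
open MeasureTheory

/-- Goal-oriented divergence
`Ξ₊(Q‖P; f) = inf_{c>0} { (1/c) Λ̃_{P,f}(c) + (1/c) R(Q‖P) }`,
where `Λ̃_{P,f}(c) = log E_P(e^{c(f − E_P f)})`; the infimum is taken over those `c > 0`
for which the cumulant generating function is finite (i.e. `e^{c(f−E_P f)}` is
`P`-integrable). -/
noncomputable def XiPlus {Ω : Type*} [MeasurableSpace Ω] (Q P : Measure Ω) (f : Ω → ℝ) : ℝ :=
  sInf {t : ℝ | ∃ c : ℝ, 0 < c ∧
    Integrable (fun x => Real.exp (c * (f x - ∫ z, f z ∂P))) P ∧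
    t = (1 / c) * Real.log (∫ x, Real.exp (c * (f x - ∫ z, f z ∂P)) ∂P)
        + (1 / c) * relEnt Q P}

/-- Goal-oriented divergence
`Ξ₋(Q‖P; f) = sup_{c>0} { −(1/c) Λ̃_{P,f}(−c) − (1/c) R(Q‖P) }`. -/
noncomputable def XiMinus {Ω : Type*} [MeasurableSpace Ω] (Q P : Measure Ω) (f : Ω → ℝ) : ℝ :=
  sSup {t : ℝ | ∃ c : ℝ, 0 < c ∧
    Integrable (fun x => Real.exp (-c * (f x - ∫ z, f z ∂P))) P ∧
    t = -(1 / c) * Real.log (∫ x, Real.exp (-c * (f x - ∫ z, f z ∂P)) ∂P)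
        - (1 / c) * relEnt Q P}

/-- **Gibbs variational inequality**: `E_Q(g) ≤ log E_P(e^g) + R(Q‖P)`. -/
theorem integral_le_log_integral_exp_add_relEnt {Ω : Type*} [MeasurableSpace Ω]
    {P Q : Measure Ω} [IsProbabilityMeasure P] [IsProbabilityMeasure Q] (hQP : Q ≪ P)
    {g : Ω → ℝ} (hgQ : Integrable g Q) (hexp : Integrable (fun x => Real.exp (g x)) P)
    (hR : Integrable (fun x => Real.log ((Q.rnDeriv P x).toReal)) Q) :
    ∫ x, g x ∂Q ≤ Real.log (∫ x, Real.exp (g x) ∂P) + relEnt Q P := by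
  set Z := ∫ x, Real.exp (g x) ∂P with hZ
  have hZpos : 0 < Z := integral_exp_pos hexp
  set r : Ω → ℝ := fun x => (Q.rnDeriv P x).toReal with hr
  have hr_meas : Measurable r := (Measure.measurable_rnDeriv Q P).ennreal_toReal
  have hr_pos : ∀ᵐ x ∂Q, 0 < r x := by
    filter_upwards [Measure.rnDeriv_pos hQP, hQP.ae_le (Measure.rnDeriv_lt_top Q P)]
      with x h₀ h₁
    exact ENNReal.toReal_pos h₀.ne' h₁.ne
  have hle : ∀ x, r x * (Real.exp (g x) / r x) ≤ Real.exp (g x) := fun x => by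
    by_cases h : r x = 0
    · simp [h, (Real.exp_pos (g x)).le]
    · rw [mul_div_cancel₀ _ h]
  have hprod : Integrable (fun x => r x * (Real.exp (g x) / r x)) P := by
    refine hexp.mono' ?_ (ae_of_all _ fun x => ?_)
    · exact hr_meas.aestronglyMeasurable.mul
        (hexp.aestronglyMeasurable.aemeasurable.div hr_meas.aemeasurable).aestronglyMeasurable
    · have : 0 ≤ r x := ENNReal.toReal_nonneg
      rw [Real.norm_of_nonneg (by positivity)]
      exact hle x
  have hdiv : Integrable (fun x => Real.exp (g x) / r x) Q :=
    (integrable_rnDeriv_smul_iff hQP).1 hprod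
  have hdiv_le : ∫ x, Real.exp (g x) / r x ∂Q ≤ Z := by
    rw [← integral_rnDeriv_smul hQP]
    exact integral_mono hprod hexp hle
  have key : ∫ x, (g x - Real.log (r x)) ∂Q
      ≤ ∫ x, (Real.exp (g x) / r x / Z + (Real.log Z - 1)) ∂Q := by
    refine integral_mono_ae (hgQ.sub hR) ((hdiv.div_const Z).add (integrable_const _)) ?_
    filter_upwards [hr_pos] with x hx
    have h := Real.log_le_sub_one_of_pos (x := Real.exp (g x) / r x / Z) (by positivity)
    rw [Real.log_div (by positivity) hZpos.ne', Real.log_div (by positivity) hx.ne',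
      Real.log_exp] at h
    linarith
  rw [integral_sub hgQ hR, integral_add (hdiv.div_const Z) (integrable_const _),
    integral_div, integral_const] at key
  have : (∫ x, Real.exp (g x) / r x ∂Q) / Z ≤ 1 := (div_le_one hZpos).2 hdiv_le
  simp only [probReal_univ, one_smul] at key
  unfold relEnt
  linarith

/-- The Gibbs variational inequality for a scaled, translated observable. -/
theorem mul_integral_sub_le_log_integral_exp_add_relEnt {Ω : Type*} [MeasurableSpace Ω]
    {P Q : Measure Ω} [IsProbabilityMeasure P] [IsProbabilityMeasure Q] (hQP : Q ≪ P)
    {f : Ω → ℝ} (hfQ : Integrable f Q)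
    (hR : Integrable (fun x => Real.log ((Q.rnDeriv P x).toReal)) Q) (c m : ℝ)
    (hexp : Integrable (fun x => Real.exp (c * (f x - m))) P) :
    c * ((∫ x, f x ∂Q) - m) ≤
      Real.log (∫ x, Real.exp (c * (f x - m)) ∂P) + relEnt Q P := by
  have h := integral_le_log_integral_exp_add_relEnt hQP
    ((hfQ.sub (integrable_const m)).const_mul c) hexp hR
  simpa [integral_const_mul, integral_sub hfQ (integrable_const m)] using h

/-- Goal-oriented divergence uncertainty quantification bound:
`Ξ₋(Q‖P; f) ≤ E_Q(f) − E_P(f) ≤ Ξ₊(Q‖P; f)`. -/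
theorem stmt_14 {Ω : Type*} [MeasurableSpace Ω] (P Q : Measure Ω)
    [IsProbabilityMeasure P] [IsProbabilityMeasure Q]
    (hQP : Q ≪ P)
    (f : Ω → ℝ) (hf : Measurable f)
    (c₀ : ℝ) (hc₀ : 0 < c₀)
    (hcgf : ∀ c : ℝ, |c| < c₀ → Integrable (fun x => Real.exp (c * f x)) P)
    (hfP : Integrable f P) (hfQ : Integrable f Q)
    (hR : Integrable (fun x => Real.log ((Q.rnDeriv P x).toReal)) Q) :
    XiMinus Q P f ≤ (∫ x, f x ∂Q) - ∫ x, f x ∂P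
    ∧ (∫ x, f x ∂Q) - (∫ x, f x ∂P) ≤ XiPlus Q P f := by
  have hint : ∀ c : ℝ, |c| < c₀ →
      Integrable (fun x => Real.exp (c * (f x - ∫ z, f z ∂P))) P := fun c hc => by
    simpa only [mul_sub, Real.exp_sub] using (hcgf c hc).div_const _
  have hhalf : |c₀ / 2| < c₀ := by rw [abs_of_pos (half_pos hc₀)]; exact half_lt_self hc₀
  constructor
  · refine csSup_le ⟨_, c₀ / 2, half_pos hc₀, hint _ (by rwa [abs_neg]), rfl⟩ ?_
    rintro t ⟨c, hc, hexp, rfl⟩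
    have h := mul_integral_sub_le_log_integral_exp_add_relEnt hQP hfQ hR (-c) _ hexp
    rw [neg_mul, ← neg_add', ← mul_add, one_div_mul_eq_div, neg_le, le_div_iff₀' hc]
    linarith
  · refine le_csInf ⟨_, c₀ / 2, half_pos hc₀, hint _ hhalf, rfl⟩ ?_
    rintro t ⟨c, hc, hexp, rfl⟩
    have h := mul_integral_sub_le_log_integral_exp_add_relEnt hQP hfQ hR c _ hexp
    rw [← mul_add, one_div_mul_eq_div, le_div_iff₀' hc]
    exact h
end

section
/- Let P and Q be probability measures with Q absolutely continuous with respect to P, and let f be a measurable real-valued function whose cumulant generating function log E_P(e^{cf}) is finite in a neighborhood of the origin. Then the goal-oriented divergences satisfy: (1) Ξ₊(Q‖P; f) ≥ 0 and Ξ₋(Q‖P; f) ≤ 0; (2) Ξ₊(Q‖P; f) = 0 (equivalently, Ξ₋(Q‖P; f) = 0) if and only if Q = P almost surely or f is constant P-almost surely. -/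
open MeasureTheory

open ProbabilityTheory

section XiPlus

variable {Ω : Type*} [MeasurableSpace Ω] {P Q : Measure Ω} {f g : Ω → ℝ} {c c₁ : ℝ}

/-- `E[e^g] ≥ 1` for a centered `g`. -/
lemma one_le_integral_exp_of_integral_eq_zero [IsProbabilityMeasure P] (hg : Integrable g P)
    (hg0 : ∫ x, g x ∂P = 0) (he : Integrable (fun x => Real.exp (g x)) P) :
    1 ≤ ∫ x, Real.exp (g x) ∂P := by
  have h : ∫ x, (g x + 1) ∂P ≤ ∫ x, Real.exp (g x) ∂P :=
    integral_mono (hg.add (integrable_const 1)) he fun x => Real.add_one_le_exp (g x)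
  rw [integral_add hg (integrable_const 1), hg0] at h
  simpa using h

/-- A centered `g` with `E[e^g] = 1` vanishes almost surely. -/
lemma ae_eq_zero_of_integral_exp_eq_one [IsProbabilityMeasure P] (hg : Integrable g P)
    (hg0 : ∫ x, g x ∂P = 0) (he : Integrable (fun x => Real.exp (g x)) P)
    (h1 : ∫ x, Real.exp (g x) ∂P = 1) : g =ᵐ[P] 0 := by
  have hi : Integrable (fun x => g x + 1) P := hg.add (integrable_const 1)
  have h0 : ∫ x, (Real.exp (g x) - (g x + 1)) ∂P = 0 := by
    rw [integral_sub he hi, integral_add hg (integrable_const 1), hg0, h1]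
    simp
  rw [integral_eq_zero_iff_of_nonneg
    (fun x => sub_nonneg.2 (Real.add_one_le_exp (g x))) (he.sub hi)] at h0
  filter_upwards [h0] with x hx
  by_contra hne
  have := Real.add_one_lt_exp hne
  simp only [Pi.zero_apply] at hx
  linarith

/-- The map `c ↦ (1 / c) log E[e^{c g}]` is nondecreasing on the positive reals. -/
lemma one_div_mul_log_integral_exp_le [IsProbabilityMeasure P] (hc₁ : 0 < c₁) (hcc : c₁ ≤ c)
    (h₁ : Integrable (fun x => Real.exp (c₁ * g x)) P)
    (h : Integrable (fun x => Real.exp (c * g x)) P) :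
    (1 / c₁) * Real.log (∫ x, Real.exp (c₁ * g x) ∂P)
      ≤ (1 / c) * Real.log (∫ x, Real.exp (c * g x) ∂P) := by
  have hc : 0 < c := hc₁.trans_le hcc
  have hp : 1 ≤ c / c₁ := (one_le_div hc₁).2 hcc
  have hpow : ∀ x, Real.exp (c₁ * g x) ^ (c / c₁) = Real.exp (c * g x) := fun x => by
    rw [← Real.exp_mul]
    congr 1
    field_simp
  have hpos : 0 < ∫ x, Real.exp (c₁ * g x) ∂P := integral_exp_pos h₁
  have hj : (∫ x, Real.exp (c₁ * g x) ∂P) ^ (c / c₁) ≤ ∫ x, Real.exp (c * g x) ∂P := by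
    have := (convexOn_rpow hp).map_integral_le (μ := P) (f := fun x => Real.exp (c₁ * g x))
      (Real.continuous_rpow_const (by linarith)).continuousOn isClosed_Ici
      (.of_forall fun x => (Real.exp_pos _).le) h₁ (by simpa only [Function.comp_def, hpow] using h)
    simpa only [hpow] using this
  have hl := Real.log_le_log (Real.rpow_pos_of_pos hpos _) hj
  rw [Real.log_rpow hpos] at hl
  calc (1 / c₁) * Real.log (∫ x, Real.exp (c₁ * g x) ∂P)
      = (1 / c) * (c / c₁ * Real.log (∫ x, Real.exp (c₁ * g x) ∂P)) := by field_simp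
    _ ≤ _ := by gcongr

lemma relEnt_eq_toReal_klDiv [IsProbabilityMeasure P] [IsProbabilityMeasure Q] (hQP : Q ≪ P) :
    relEnt Q P = (InformationTheory.klDiv Q P).toReal := by
  rw [InformationTheory.toReal_klDiv_of_measure_eq hQP (by simp)]
  rfl

lemma relEnt_nonneg [IsProbabilityMeasure P] [IsProbabilityMeasure Q] (hQP : Q ≪ P) :
    0 ≤ relEnt Q P :=
  relEnt_eq_toReal_klDiv hQP ▸ ENNReal.toReal_nonneg

lemma relEnt_eq_zero_iff [IsProbabilityMeasure P] [IsProbabilityMeasure Q] (hQP : Q ≪ P)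
    (hR : Integrable (fun x => Real.log ((Q.rnDeriv P x).toReal)) Q) :
    relEnt Q P = 0 ↔ Q = P := by
  rw [relEnt_eq_toReal_klDiv hQP, ENNReal.toReal_eq_zero_iff,
    InformationTheory.klDiv_eq_zero_iff]
  exact or_iff_left (InformationTheory.klDiv_ne_top hQP hR)

lemma integral_sub_mean [IsProbabilityMeasure P] (hfP : Integrable f P) :
    ∫ x, (f x - ∫ z, f z ∂P) ∂P = 0 := by
  rw [integral_sub hfP (integrable_const _)]
  simp

lemma log_integral_exp_centered_nonneg [IsProbabilityMeasure P] (hfP : Integrable f P)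
    (h : Integrable (fun x => Real.exp (c * (f x - ∫ z, f z ∂P))) P) :
    0 ≤ Real.log (∫ x, Real.exp (c * (f x - ∫ z, f z ∂P)) ∂P) :=
  Real.log_nonneg <| one_le_integral_exp_of_integral_eq_zero
    ((hfP.sub (integrable_const _)).const_mul c)
    (by rw [integral_const_mul, integral_sub_mean hfP, mul_zero]) h

lemma log_integral_exp_centered_pos [IsProbabilityMeasure P] (hfP : Integrable f P) (hc : 0 < c)
    (h : Integrable (fun x => Real.exp (c * (f x - ∫ z, f z ∂P))) P)
    (hf : ¬ ∃ a : ℝ, f =ᵐ[P] fun _ => a) :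
    0 < Real.log (∫ x, Real.exp (c * (f x - ∫ z, f z ∂P)) ∂P) := by
  have hi : Integrable (fun x => c * (f x - ∫ z, f z ∂P)) P :=
    (hfP.sub (integrable_const _)).const_mul c
  have h0 : ∫ x, c * (f x - ∫ z, f z ∂P) ∂P = 0 := by
    rw [integral_const_mul, integral_sub_mean hfP, mul_zero]
  refine Real.log_pos <| (one_le_integral_exp_of_integral_eq_zero hi h0 h).lt_of_ne' fun h1 =>
    hf ⟨∫ z, f z ∂P, ?_⟩
  filter_upwards [ae_eq_zero_of_integral_exp_eq_one hi h0 h h1] with x hx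
  have := (mul_eq_zero.1 hx).resolve_left hc.ne'
  linarith

lemma integrable_exp_centered (h : Integrable (fun x => Real.exp (c * f x)) P) :
    Integrable (fun x => Real.exp (c * (f x - ∫ z, f z ∂P))) P := by
  refine (h.mul_const (Real.exp (-(c * ∫ z, f z ∂P)))).congr (.of_forall fun x => ?_)
  simp only [← Real.exp_add]
  congr 1
  ring

/-- For an integrable variable with exponential moments near the origin, the centered cumulant
generating function is `o(c)` at `0`. -/
lemma exists_one_div_mul_log_integral_exp_lt [IsProbabilityMeasure P] (hfP : Integrable f P)
    {c₀ : ℝ} (hc₀ : 0 < c₀)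
    (hcgf : ∀ c : ℝ, |c| < c₀ → Integrable (fun x => Real.exp (c * f x)) P)
    {ε : ℝ} (hε : 0 < ε) :
    ∃ c, 0 < c ∧ Integrable (fun x => Real.exp (c * (f x - ∫ z, f z ∂P))) P ∧
      (1 / c) * Real.log (∫ x, Real.exp (c * (f x - ∫ z, f z ∂P)) ∂P) < ε := by
  set g : Ω → ℝ := fun x => f x - ∫ z, f z ∂P with hg
  have hint : (0 : ℝ) ∈ interior (integrableExpSet g P) := by
    refine mem_interior.2 ⟨Metric.ball 0 c₀, fun c hc => ?_, Metric.isOpen_ball,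
      Metric.mem_ball_self hc₀⟩
    exact integrable_exp_centered (hcgf c (by simpa using hc))
  have hd : HasDerivAt (cgf g P) 0 0 := by
    have := (analyticAt_cgf hint).differentiableAt.hasDerivAt
    rw [deriv_cgf_zero hint, integral_sub_mean hfP, zero_div] at this
    exact this
  have ht := hd.tendsto_slope_zero_right
  have hsmall : ∀ᶠ c in nhdsWithin (0 : ℝ) (Set.Ioi 0), c < c₀ :=
    nhdsWithin_le_nhds (Iio_mem_nhds hc₀)
  obtain ⟨c, hlt, hcc, hc⟩ :=
    ((ht.eventually_lt_const hε).and (hsmall.and self_mem_nhdsWithin)).exists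
  refine ⟨c, hc, integrable_exp_centered (hcgf c (by rwa [abs_of_pos hc])), ?_⟩
  simpa [cgf, mgf] using hlt

lemma XiPlus_nonneg [IsProbabilityMeasure P] [IsProbabilityMeasure Q] (hQP : Q ≪ P)
    (hfP : Integrable f P) : 0 ≤ XiPlus Q P f := by
  refine Real.sInf_nonneg ?_
  rintro t ⟨c, hc, hi, rfl⟩
  have := log_integral_exp_centered_nonneg hfP hi
  have := relEnt_nonneg hQP
  positivity

lemma XiPlus_le [IsProbabilityMeasure P] [IsProbabilityMeasure Q] (hQP : Q ≪ P)
    (hfP : Integrable f P) (hc : 0 < c)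
    (hi : Integrable (fun x => Real.exp (c * (f x - ∫ z, f z ∂P))) P) :
    XiPlus Q P f ≤ (1 / c) * Real.log (∫ x, Real.exp (c * (f x - ∫ z, f z ∂P)) ∂P)
        + (1 / c) * relEnt Q P := by
  refine csInf_le ⟨0, ?_⟩ ⟨c, hc, hi, rfl⟩
  rintro t ⟨c, hc, hi, rfl⟩
  have := log_integral_exp_centered_nonneg hfP hi
  have := relEnt_nonneg hQP
  positivity

lemma XiPlus_pos [IsProbabilityMeasure P] [IsProbabilityMeasure Q] (hQP : Q ≪ P)
    (hfP : Integrable f P)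
    (hR : Integrable (fun x => Real.log ((Q.rnDeriv P x).toReal)) Q) (hne : Q ≠ P)
    (hf : ¬ ∃ a : ℝ, f =ᵐ[P] fun _ => a) (hc₁ : 0 < c₁)
    (h₁ : Integrable (fun x => Real.exp (c₁ * (f x - ∫ z, f z ∂P))) P) :
    0 < XiPlus Q P f := by
  have hRpos : 0 < relEnt Q P :=
    (relEnt_nonneg hQP).lt_of_ne' fun h => hne ((relEnt_eq_zero_iff hQP hR).1 h)
  have hΛ := log_integral_exp_centered_pos hfP hc₁ h₁ hf
  refine (lt_min (mul_pos (one_div_pos.2 hc₁) hRpos)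
    (mul_pos (one_div_pos.2 hc₁) hΛ)).trans_le (le_csInf ⟨_, c₁, hc₁, h₁, rfl⟩ ?_)
  rintro t ⟨c, hc, hi, rfl⟩
  have hΛc := log_integral_exp_centered_nonneg hfP hi
  rcases le_total c c₁ with h | h
  · refine (min_le_left _ _).trans (le_add_of_nonneg_of_le (by positivity) ?_)
    gcongr
  · exact (min_le_right _ _).trans (le_add_of_le_of_nonneg
      (one_div_mul_log_integral_exp_le hc₁ h h₁ hi) (by positivity))

lemma XiPlus_eq_zero_iff [IsProbabilityMeasure P] [IsProbabilityMeasure Q] (hQP : Q ≪ P)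
    {c₀ : ℝ} (hc₀ : 0 < c₀)
    (hcgf : ∀ c : ℝ, |c| < c₀ → Integrable (fun x => Real.exp (c * f x)) P)
    (hfP : Integrable f P)
    (hR : Integrable (fun x => Real.log ((Q.rnDeriv P x).toReal)) Q) :
    XiPlus Q P f = 0 ↔ (Q = P ∨ ∃ a : ℝ, f =ᵐ[P] fun _ => a) := by
  constructor
  · intro h
    by_contra! hcon
    refine (XiPlus_pos hQP hfP hR hcon.1 (fun ⟨a, ha⟩ => hcon.2 a ha) (half_pos hc₀)
      (integrable_exp_centered (hcgf _ ?_))).ne' h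
    rw [abs_of_pos (half_pos hc₀)]
    exact half_lt_self hc₀
  · intro h
    refine le_antisymm (le_of_forall_pos_le_add fun ε hε => ?_) (XiPlus_nonneg hQP hfP)
    rw [zero_add]
    rcases h with h | ⟨a, ha⟩
    · obtain ⟨c, hc, hi, hlt⟩ := exists_one_div_mul_log_integral_exp_lt hfP hc₀ hcgf hε
      have := XiPlus_le hQP hfP hc hi
      rw [(relEnt_eq_zero_iff hQP hR).2 h, mul_zero, add_zero] at this
      exact this.trans hlt.le
    · have hR0 := relEnt_nonneg hQP
      have hmean : ∫ z, f z ∂P = a := by simp [integral_congr_ae ha]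
      have hexp : ∀ c : ℝ, (fun x => Real.exp (c * (f x - ∫ z, f z ∂P))) =ᵐ[P] fun _ => 1 := by
        intro c
        filter_upwards [ha] with x hx
        simp [hx, hmean]
      have hc : 0 < (relEnt Q P + 1) / ε := by positivity
      refine (XiPlus_le hQP hfP hc ((integrable_const 1).congr (hexp _).symm)).trans ?_
      rw [integral_congr_ae (hexp _)]
      simp only [integral_const, probReal_univ, smul_eq_mul, mul_one, Real.log_one, mul_zero,
        zero_add, one_div_div]
      rw [div_mul_eq_mul_div, div_le_iff₀ (by positivity)]
      nlinarith

lemma XiMinus_eq_neg_XiPlus_neg : XiMinus Q P f = -XiPlus Q P (-f) := by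
  have hint : ∀ c : ℝ, (fun x => Real.exp (c * ((-f) x - ∫ z, (-f) z ∂P)))
      = fun x => Real.exp (-c * (f x - ∫ z, f z ∂P)) := by
    intro c
    ext x
    simp only [Pi.neg_apply, integral_neg]
    congr 1
    ring
  rw [XiMinus, XiPlus, Real.sInf_def, neg_neg]
  congr 1
  ext t
  simp only [hint, Set.mem_neg, Set.mem_ofPred_eq]
  refine exists_congr fun c => and_congr_right fun _ => and_congr_right fun _ => ?_
  rw [neg_eq_iff_eq_neg, neg_add', neg_mul]

end XiPlus

/-- Properties of the goal-oriented divergences: `Ξ₊ ≥ 0`, `Ξ₋ ≤ 0`, and each vanishes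
if and only if `Q = P` or `f` is constant `P`-almost surely. -/
theorem stmt_15 {Ω : Type*} [MeasurableSpace Ω] (P Q : Measure Ω)
    [IsProbabilityMeasure P] [IsProbabilityMeasure Q]
    (hQP : Q ≪ P)
    (f : Ω → ℝ) (hf : Measurable f)
    (c₀ : ℝ) (hc₀ : 0 < c₀)
    (hcgf : ∀ c : ℝ, |c| < c₀ → Integrable (fun x => Real.exp (c * f x)) P)
    (hfP : Integrable f P)
    (hR : Integrable (fun x => Real.log ((Q.rnDeriv P x).toReal)) Q) :
    0 ≤ XiPlus Q P f
    ∧ XiMinus Q P f ≤ 0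
    ∧ (XiPlus Q P f = 0 ↔ (Q = P ∨ ∃ a : ℝ, f =ᵐ[P] fun _ => a))
    ∧ (XiMinus Q P f = 0 ↔ (Q = P ∨ ∃ a : ℝ, f =ᵐ[P] fun _ => a)) := by
  have hcgf' : ∀ c : ℝ, |c| < c₀ → Integrable (fun x => Real.exp (c * (-f) x)) P := fun c hc => by
    simpa using hcgf (-c) (by rwa [abs_neg])
  refine ⟨XiPlus_nonneg hQP hfP, ?_, XiPlus_eq_zero_iff hQP hc₀ hcgf hfP hR, ?_⟩
  · rw [XiMinus_eq_neg_XiPlus_neg]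
    exact neg_nonpos.2 (XiPlus_nonneg hQP hfP.neg)
  · rw [XiMinus_eq_neg_XiPlus_neg, neg_eq_zero,
      XiPlus_eq_zero_iff hQP hc₀ hcgf' hfP.neg hR]
    refine or_congr_right ⟨fun ⟨a, ha⟩ => ⟨-a, ?_⟩, fun ⟨a, ha⟩ => ⟨-a, ?_⟩⟩
    · filter_upwards [ha] with x hx
      rw [← hx, Pi.neg_apply, neg_neg]
    · filter_upwards [ha] with x hx
      rw [Pi.neg_apply, hx]
end

section
/- Let P and Q be mutually absolutely continuous probability measures on a measurable space, let g be a measurable function with log E_P(e^{cg}) finite in a neighborhood of the origin, and for N ≥ 1 let P_N = P^{⊗N}, Q_N = Q^{⊗N} and f_N(σ₁,…,σ_N) = (1/N) Σ_{j=1}^N g(σ_j). Then the goal-oriented divergences scale linearly with system size: Ξ₊(Q_N‖P_N; N f_N) = N · Ξ₊(Q‖P; g) and Ξ₋(Q_N‖P_N; N f_N) = N · Ξ₋(Q‖P; g). In particular the resulting bounds on E_{Q_N}(f_N) − E_{P_N}(f_N) are uniform in N. -/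
open MeasureTheory

open scoped ENNReal

theorem exp_mul_centered_sum {Ω ι : Type*} [Fintype ι] (c m : ℝ) (g : Ω → ℝ) (x : ι → Ω) :
    Real.exp (c * (∑ i, g (x i) - Fintype.card ι * m)) = ∏ i, Real.exp (c * (g (x i) - m)) := by
  rw [← Real.exp_sum, ← Finset.mul_sum, Finset.sum_sub_distrib]
  simp

section PiConstant

variable {Ω : Type*} [MeasurableSpace Ω] {ι : Type*} [Fintype ι]

/-- Tonelli's theorem for a product of functions of the separate coordinates. -/
theorem lintegral_pi_prod_eq_prod_lintegral (P : Measure Ω) [IsProbabilityMeasure P]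
    {f : ι → Ω → ℝ≥0∞} (hf : ∀ i, Measurable (f i)) :
    ∫⁻ x, ∏ i, f i (x i) ∂(Measure.pi fun _ : ι => P) = ∏ i, ∫⁻ x, f i x ∂P := by
  have hind := ProbabilityTheory.iIndepFun_pi (μ := fun _ : ι => P) (X := f)
    fun i => (hf i).aemeasurable
  rw [ProbabilityTheory.lintegral_prod_eq_prod_lintegral_of_indepFun Finset.univ _ hind
    fun i => (hf i).comp (measurable_pi_apply i)]
  refine Finset.prod_congr rfl fun i _ => ?_
  exact (measurePreserving_eval (fun _ : ι => P) i).lintegral_comp (hf i)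

/-- A product of copies of a nonnegative function is integrable only if the function is. -/
theorem integrable_pi_prod_iff [Nonempty ι] (P : Measure Ω) [IsProbabilityMeasure P]
    {f : Ω → ℝ} (hf : Measurable f) (hf0 : ∀ x, 0 ≤ f x) :
    Integrable (fun x : ι → Ω => ∏ i, f (x i)) (Measure.pi fun _ => P) ↔ Integrable f P := by
  refine ⟨fun h => ⟨hf.aestronglyMeasurable, ?_⟩, fun h => Integrable.fintype_prod fun _ => h⟩
  rw [hasFiniteIntegral_iff_ofReal (ae_of_all _ hf0)]
  have h2 := h.2
  rw [hasFiniteIntegral_iff_ofReal (ae_of_all _ fun x => Finset.prod_nonneg fun i _ => hf0 _)] at h2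
  simp_rw [ENNReal.ofReal_prod_of_nonneg fun i _ => hf0 _] at h2
  rw [lintegral_pi_prod_eq_prod_lintegral P fun _ => hf.ennreal_ofReal, Finset.prod_const,
    ENNReal.pow_lt_top_iff] at h2
  exact h2.resolve_right (by simp)

theorem withDensity_pi_prod (P : Measure Ω) [IsProbabilityMeasure P]
    {f : Ω → ℝ≥0∞} (hf : Measurable f) [SigmaFinite (P.withDensity f)] :
    (Measure.pi fun _ : ι => P).withDensity (fun x => ∏ i, f (x i))
      = Measure.pi fun _ => P.withDensity f := by
  refine (Measure.pi_eq fun s hs => ?_).symm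
  rw [withDensity_apply _ (MeasurableSet.univ_pi hs), ← lintegral_indicator (.univ_pi hs)]
  have hind : (Set.univ.pi s).indicator (fun x : ι → Ω => ∏ i, f (x i))
      = fun x => ∏ i, (s i).indicator f (x i) := by
    funext x
    by_cases hx : x ∈ Set.univ.pi s
    · rw [Set.indicator_of_mem hx]
      exact Finset.prod_congr rfl fun i _ => (Set.indicator_of_mem (hx i trivial) f).symm
    · rw [Set.indicator_of_notMem hx]
      obtain ⟨i, hi⟩ : ∃ i, x i ∉ s i := by simpa [Set.mem_pi] using hx
      exact (Finset.prod_eq_zero (Finset.mem_univ i) (Set.indicator_of_notMem hi f)).symm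
  rw [hind, lintegral_pi_prod_eq_prod_lintegral P fun i => hf.indicator (hs i)]
  exact Finset.prod_congr rfl fun i _ => by
    rw [lintegral_indicator (hs i), withDensity_apply _ (hs i)]

/-- Relative entropy is additive over independent copies. -/
theorem relEnt_pi (P Q : Measure Ω) [IsProbabilityMeasure P] [IsProbabilityMeasure Q]
    (hQP : Q ≪ P) (hR : Integrable (fun x => Real.log ((Q.rnDeriv P x).toReal)) Q) :
    relEnt (Measure.pi fun _ : ι => Q) (Measure.pi fun _ : ι => P)
      = Fintype.card ι * relEnt Q P := by
  have hQ : P.withDensity (Q.rnDeriv P) = Q := Measure.withDensity_rnDeriv_eq Q P hQP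
  have : SigmaFinite (P.withDensity (Q.rnDeriv P)) := by rw [hQ]; infer_instance
  have hdens := withDensity_pi_prod (ι := ι) P (Measure.measurable_rnDeriv Q P)
  simp_rw [hQ] at hdens
  have hac : (Measure.pi fun _ : ι => Q) ≪ Measure.pi fun _ : ι => P := by
    rw [← hdens]
    exact withDensity_absolutelyContinuous _ _
  have hder := Measure.rnDeriv_withDensity (Measure.pi fun _ : ι => P)
    (f := fun x : ι → Ω => ∏ i, Q.rnDeriv P (x i))
    (Finset.measurable_prod _ fun i _ =>
      (Measure.measurable_rnDeriv Q P).comp (measurable_pi_apply i))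
  rw [hdens] at hder
  have hpos : ∀ᵐ x ∂(Measure.pi fun _ : ι => Q), ∀ i, (Q.rnDeriv P (x i)).toReal ≠ 0 := by
    refine ae_all_iff.2 fun i => ?_
    refine (measurePreserving_eval (fun _ : ι => Q) i).quasiMeasurePreserving.ae
      (p := fun y => (Q.rnDeriv P y).toReal ≠ 0) ?_
    filter_upwards [Measure.rnDeriv_pos hQP, hQP.ae_le (Measure.rnDeriv_ne_top Q P)] with x h0 h1
    exact (ENNReal.toReal_pos h0.ne' h1).ne'
  have hlog : (fun x => Real.log
        (((Measure.pi fun _ : ι => Q).rnDeriv (Measure.pi fun _ : ι => P) x).toReal))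
      =ᵐ[Measure.pi fun _ : ι => Q]
        fun x => ∑ i, Real.log ((Q.rnDeriv P (x i)).toReal) := by
    filter_upwards [hac.ae_le hder, hpos] with x hx h0
    rw [hx, ENNReal.toReal_prod, Real.log_prod fun i _ => h0 i]
  rw [relEnt, integral_congr_ae hlog,
    integral_finsetSum _ fun i _ => integrable_comp_eval (μ := fun _ : ι => Q) hR]
  simp_rw [integral_comp_eval (μ := fun _ : ι => Q) hR.aestronglyMeasurable]
  simp [relEnt]

theorem integral_pi_sum (P : Measure Ω) [IsProbabilityMeasure P] {g : Ω → ℝ}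
    (hg : Integrable g P) :
    ∫ x : ι → Ω, ∑ i, g (x i) ∂(Measure.pi fun _ => P) = Fintype.card ι * ∫ x, g x ∂P := by
  rw [integral_finsetSum _ fun i _ => integrable_comp_eval (μ := fun _ : ι => P) hg]
  simp_rw [integral_comp_eval (μ := fun _ : ι => P) hg.aestronglyMeasurable]
  simp

theorem XiPlus_pi [Nonempty ι] (P Q : Measure Ω) [IsProbabilityMeasure P] [IsProbabilityMeasure Q]
    (hQP : Q ≪ P) (hR : Integrable (fun x => Real.log ((Q.rnDeriv P x).toReal)) Q)
    {g : Ω → ℝ} (hg : Measurable g) (hgi : Integrable g P) :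
    XiPlus (Measure.pi fun _ : ι => Q) (Measure.pi fun _ : ι => P) (fun x => ∑ i, g (x i))
      = Fintype.card ι * XiPlus Q P g := by
  rw [XiPlus, XiPlus, ← smul_eq_mul, ← Real.sInf_smul_of_nonneg (Nat.cast_nonneg _)]
  congr 1
  ext t
  have hm : ∀ c, Measurable fun x => Real.exp (c * (g x - ∫ z, g z ∂P)) := fun c => by fun_prop
  have hlog : ∀ c, Real.log (∫ x : ι → Ω, ∏ i, Real.exp (c * (g (x i) - ∫ z, g z ∂P))
      ∂(Measure.pi fun _ => P))
      = Fintype.card ι * Real.log (∫ x, Real.exp (c * (g x - ∫ z, g z ∂P)) ∂P) := fun c => by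
    rw [integral_fintype_prod_eq_pow fun x => Real.exp (c * (g x - ∫ z, g z ∂P)), Real.log_pow]
  simp only [Set.mem_smul_set, Set.mem_ofPred_eq, integral_pi_sum P hgi, exp_mul_centered_sum,
    integrable_pi_prod_iff P (hm _) fun _ => (Real.exp_pos _).le,
    hlog, relEnt_pi P Q hQP hR, smul_eq_mul]
  constructor
  · rintro ⟨c, hc, hi, rfl⟩
    exact ⟨_, ⟨c, hc, hi, rfl⟩, by ring⟩
  · rintro ⟨_, ⟨c, hc, hi, rfl⟩, rfl⟩
    exact ⟨c, hc, hi, by ring⟩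

theorem XiMinus_pi [Nonempty ι] (P Q : Measure Ω) [IsProbabilityMeasure P] [IsProbabilityMeasure Q]
    (hQP : Q ≪ P) (hR : Integrable (fun x => Real.log ((Q.rnDeriv P x).toReal)) Q)
    {g : Ω → ℝ} (hg : Measurable g) (hgi : Integrable g P) :
    XiMinus (Measure.pi fun _ : ι => Q) (Measure.pi fun _ : ι => P) (fun x => ∑ i, g (x i))
      = Fintype.card ι * XiMinus Q P g := by
  rw [XiMinus, XiMinus, ← smul_eq_mul, ← Real.sSup_smul_of_nonneg (Nat.cast_nonneg _)]
  congr 1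
  ext t
  have hm : ∀ c, Measurable fun x => Real.exp (c * (g x - ∫ z, g z ∂P)) := fun c => by fun_prop
  have hlog : ∀ c, Real.log (∫ x : ι → Ω, ∏ i, Real.exp (c * (g (x i) - ∫ z, g z ∂P))
      ∂(Measure.pi fun _ => P))
      = Fintype.card ι * Real.log (∫ x, Real.exp (c * (g x - ∫ z, g z ∂P)) ∂P) := fun c => by
    rw [integral_fintype_prod_eq_pow fun x => Real.exp (c * (g x - ∫ z, g z ∂P)), Real.log_pow]
  simp only [Set.mem_smul_set, Set.mem_ofPred_eq, integral_pi_sum P hgi, exp_mul_centered_sum,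
    integrable_pi_prod_iff P (hm _) fun _ => (Real.exp_pos _).le,
    hlog, relEnt_pi P Q hQP hR, smul_eq_mul]
  constructor
  · rintro ⟨c, hc, hi, rfl⟩
    exact ⟨_, ⟨c, hc, hi, rfl⟩, by ring⟩
  · rintro ⟨_, ⟨c, hc, hi, rfl⟩, rfl⟩
    exact ⟨c, hc, hi, by ring⟩

end PiConstant

/-- Linear scaling of the goal-oriented divergences with system size:
for product measures `P_N = P^{⊗N}`, `Q_N = Q^{⊗N}` and the ergodic-average observable
`f_N(σ) = (1/N) Σ_j g(σ_j)`, one has `Ξ±(Q_N‖P_N; N f_N) = N · Ξ±(Q‖P; g)`. -/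
theorem stmt_16 {Ω : Type*} [MeasurableSpace Ω] (P Q : Measure Ω)
    [IsProbabilityMeasure P] [IsProbabilityMeasure Q]
    (hQP : Q ≪ P) (hPQ : P ≪ Q)
    (g : Ω → ℝ) (hg : Measurable g)
    (c₀ : ℝ) (hc₀ : 0 < c₀)
    (hcgf : ∀ c : ℝ, |c| < c₀ → Integrable (fun x => Real.exp (c * g x)) P)
    (hR : Integrable (fun x => Real.log ((Q.rnDeriv P x).toReal)) Q)
    (N : ℕ) (hN : 1 ≤ N) :
    XiPlus (Measure.pi fun _ : Fin N => Q) (Measure.pi fun _ : Fin N => P)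
        (fun σ => ∑ j : Fin N, g (σ j))
      = N * XiPlus Q P g
    ∧ XiMinus (Measure.pi fun _ : Fin N => Q) (Measure.pi fun _ : Fin N => P)
        (fun σ => ∑ j : Fin N, g (σ j))
      = N * XiMinus Q P g := by
  have : Nonempty (Fin N) := ⟨⟨0, hN⟩⟩
  have hgi : Integrable g P := by
    refine ProbabilityTheory.integrable_of_mem_interior_integrableExpSet ?_
    refine mem_interior.2 ⟨Set.Ioo (-c₀) c₀, fun c hc => ?_, isOpen_Ioo, by simpa using hc₀⟩
    exact hcgf c (abs_lt.2 hc)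
  have hplus := XiPlus_pi (ι := Fin N) P Q hQP hR hg hgi
  have hminus := XiMinus_pi (ι := Fin N) P Q hQP hR hg hgi
  rw [Fintype.card_fin] at hplus hminus
  exact ⟨hplus, hminus⟩
end

section
/- Let p and q be transition matrices of two irreducible Markov chains on a finite state space S with stationary distributions μ_p and μ_q, and assume p(x,·) and q(x,·) are mutually absolutely continuous for each x ∈ S. For any real-valued observable g on S, ξ₋(q‖p; g) ≤ E_{μ_q}(g) − E_{μ_p}(g) ≤ ξ₊(q‖p; g), where ξ₊(q‖p; g) = inf_{c>0} { (1/c) λ_{p,g}(c) + (1/c) r(q‖p) } and ξ₋(q‖p; g) = sup_{c>0} { −(1/c) λ_{p,g}(−c) − (1/c) r(q‖p) }; here λ_{p,g}(c) is the logarithm of the maximal (Perron–Frobenius) eigenvalue of the nonnegative matrix with entries p(x,y)·exp(c(g(y) − E_{μ_p}(g))), and r(q‖p) = Σ_{x,y} μ_q(x) q(x,y) log(q(x,y)/p(x,y)) is the relative entropy rate. (Uncertainty quantification bound for stationary distributions of Markov chains.) -/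
open Finset

/-- The weighted form of `log t ≤ t - 1` for `t = a * exp u * w / (b * exp l * v)`. -/
theorem mul_add_log_sub_le {a b u l w v : ℝ} (ha : 0 ≤ a) (hb : 0 ≤ b) (hab : a = 0 ↔ b = 0)
    (hw : 0 < w) (hv : 0 < v) :
    b * (u + Real.log w - Real.log v - l - Real.log (b / a))
      ≤ a * Real.exp u * w / (Real.exp l * v) - b := by
  rcases hb.eq_or_lt with rfl | hb
  · simp [hab.2 rfl]
  have ha : 0 < a := ha.lt_of_ne fun h => hb.ne' (hab.1 h.symm)
  have hE := Real.exp_pos u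
  have hL := Real.exp_pos l
  have hlog := Real.log_le_sub_one_of_pos
    (show 0 < a * Real.exp u * w / (b * (Real.exp l * v)) by positivity)
  rw [Real.log_div (by positivity) (by positivity), Real.log_mul (by positivity) hw.ne',
    Real.log_mul ha.ne' hE.ne', Real.log_mul hb.ne' (by positivity),
    Real.log_mul hL.ne' hv.ne', Real.log_exp, Real.log_exp] at hlog
  rw [Real.log_div hb.ne' ha.ne']
  calc b * (u + Real.log w - Real.log v - l - (Real.log b - Real.log a))
      ≤ b * (a * Real.exp u * w / (b * (Real.exp l * v)) - 1) :=
        mul_le_mul_of_nonneg_left (by linarith) hb.le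
    _ = a * Real.exp u * w / (Real.exp l * v) - b := by field_simp

/-- Donsker–Varadhan type inequality: if the tilted matrix `p x y * exp (f y)` has a positive
eigenvector with eigenvalue `exp l`, then the stationary mean of `f` under `q` is at most `l` plus
the relative entropy rate of `q` with respect to `p`. -/
theorem sum_stationary_mul_le_add_relEntropyRate {S : Type*} [Fintype S]
    {p q : Matrix S S ℝ} {μ f v : S → ℝ} {l : ℝ}
    (hp0 : ∀ x y, 0 ≤ p x y) (hq0 : ∀ x y, 0 ≤ q x y) (hq1 : ∀ x, ∑ y, q x y = 1)
    (hrows : ∀ x y, p x y = 0 ↔ q x y = 0)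
    (hμ0 : ∀ x, 0 ≤ μ x) (hμ1 : ∑ x, μ x = 1) (hμ : ∀ y, ∑ x, μ x * q x y = μ y)
    (hv : ∀ x, 0 < v x)
    (hvl : ∀ x, ∑ y, p x y * Real.exp (f y) * v y = Real.exp l * v x) :
    ∑ x, μ x * f x ≤ l + ∑ x, ∑ y, μ x * q x y * Real.log (q x y / p x y) := by
  have hrow : ∀ x,
      ∑ y, q x y * (f y + Real.log (v y) - Real.log (v x) - l - Real.log (q x y / p x y)) ≤ 0 := by
    intro x
    have hpos : Real.exp l * v x ≠ 0 := (mul_pos (Real.exp_pos l) (hv x)).ne'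
    calc _ ≤ ∑ y, (p x y * Real.exp (f y) * v y / (Real.exp l * v x) - q x y) :=
          sum_le_sum fun y _ =>
            mul_add_log_sub_le (hp0 x y) (hq0 x y) (hrows x y) (hv y) (hv x)
      _ = 0 := by rw [sum_sub_distrib, ← sum_div, hvl, hq1, div_self hpos, sub_self]
  have hstat : ∀ F : S → ℝ, ∑ x, ∑ y, μ x * q x y * F y = ∑ x, μ x * F x := by
    intro F
    rw [sum_comm]
    exact sum_congr rfl fun y _ => by rw [← sum_mul, hμ]
  have hmass : ∀ F : S → ℝ, ∑ x, ∑ y, μ x * q x y * F x = ∑ x, μ x * F x := by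
    intro F
    exact sum_congr rfl fun x _ => by rw [← sum_mul, ← mul_sum, hq1, mul_one]
  have hsum := sum_nonpos fun x (_ : x ∈ univ) =>
    mul_nonpos_of_nonneg_of_nonpos (hμ0 x) (hrow x)
  have hl := hmass fun _ => l
  rw [← sum_mul, hμ1, one_mul] at hl
  simp only [mul_sum, ← mul_assoc, mul_sub, mul_add, sum_sub_distrib, sum_add_distrib] at hsum
  have hf := hstat f
  have hlogy := hstat fun y => Real.log (v y)
  have hlogx := hmass fun x => Real.log (v x)
  linarith

/-- Uncertainty quantification bound for stationary distributions of Markov chains: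
`ξ₋(q‖p; g) ≤ E_{μ_q}(g) − E_{μ_p}(g) ≤ ξ₊(q‖p; g)`, where
`ξ₊(q‖p; g) = inf_{c>0} { (1/c) λ_{p,g}(c) + (1/c) r(q‖p) }` and
`ξ₋(q‖p; g) = sup_{c>0} { −(1/c) λ_{p,g}(−c) − (1/c) r(q‖p) }`.
Here `λ_{p,g}(c)` is the logarithm of the Perron–Frobenius eigenvalue of the matrix
with entries `p(x,y) exp(c (g(y) − E_{μ_p}(g)))` (characterized as the eigenvalue
admitting a positive eigenvector), and `r(q‖p)` is the relative entropy rate. -/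
theorem stmt_17 {S : Type*} [Fintype S] [DecidableEq S] [Nonempty S]
    (p q : Matrix S S ℝ) (μp μq : S → ℝ) (g : S → ℝ)
    (hp0 : ∀ x y, 0 ≤ p x y) (hp1 : ∀ x, ∑ y, p x y = 1)
    (hq0 : ∀ x y, 0 ≤ q x y) (hq1 : ∀ x, ∑ y, q x y = 1)
    (hpirr : ∀ x y, ∃ n : ℕ, 0 < (p ^ n) x y)
    (hqirr : ∀ x y, ∃ n : ℕ, 0 < (q ^ n) x y)
    (hrows : ∀ x y, p x y = 0 ↔ q x y = 0)
    (hμp0 : ∀ x, 0 ≤ μp x) (hμp1 : ∑ x, μp x = 1)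
    (hμpstat : ∀ y, ∑ x, μp x * p x y = μp y)
    (hμq0 : ∀ x, 0 ≤ μq x) (hμq1 : ∑ x, μq x = 1)
    (hμqstat : ∀ y, ∑ x, μq x * q x y = μq y)
    (lam : ℝ → ℝ)
    (hlam : ∀ c : ℝ, ∃ v : S → ℝ, (∀ x, 0 < v x) ∧
      ∀ x, ∑ y, p x y * Real.exp (c * (g y - ∑ z, μp z * g z)) * v y
        = Real.exp (lam c) * v x) :
    sSup {t : ℝ | ∃ c : ℝ, 0 < c ∧
        t = -(1 / c) * lam (-c)
            - (1 / c) * ∑ x, ∑ y, μq x * q x y * Real.log (q x y / p x y)}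
      ≤ (∑ x, μq x * g x) - ∑ x, μp x * g x
    ∧ (∑ x, μq x * g x) - (∑ x, μp x * g x)
      ≤ sInf {t : ℝ | ∃ c : ℝ, 0 < c ∧
        t = (1 / c) * lam c
            + (1 / c) * ∑ x, ∑ y, μq x * q x y * Real.log (q x y / p x y)} := by
  have key : ∀ c : ℝ, c * ((∑ x, μq x * g x) - ∑ x, μp x * g x)
      ≤ lam c + ∑ x, ∑ y, μq x * q x y * Real.log (q x y / p x y) := by
    intro c
    obtain ⟨v, hv, hvl⟩ := hlam c
    refine le_of_eq_of_le ?_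
      (sum_stationary_mul_le_add_relEntropyRate hp0 hq0 hq1 hrows hμq0 hμq1 hμqstat hv hvl)
    simp only [mul_sub, mul_left_comm _ c, sum_sub_distrib, ← mul_sum, ← sum_mul, hμq1, one_mul]
  constructor
  · refine csSup_le ⟨_, 1, one_pos, rfl⟩ ?_
    rintro t ⟨c, hc, rfl⟩
    rw [neg_mul, one_div_mul_eq_div, one_div_mul_eq_div, neg_sub_left, ← add_div, ← neg_div,
      div_le_iff₀ hc]
    linarith [key (-c)]
  · refine le_csInf ⟨_, 1, one_pos, rfl⟩ ?_
    rintro t ⟨c, hc, rfl⟩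
    rw [one_div_mul_eq_div, one_div_mul_eq_div, ← add_div, le_div_iff₀ hc]
    linarith [key c]
end
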